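/- arXiv:1502.07656 — 2 statements merged into one kernel-verified Lean document; each statement's English description precedes it below -/
import Mathlib

section
/- The map sending a partition λ to the tuple Λ^λ = (λ_1, …, λ_m, max(0, λ'_1 − m), …, max(0, λ'_n − m)) is a bijection from the set H of partitions satisfying the (m|n)-hook condition λ_{m+1} ≤ n onto the set of tuples (μ_1,…,μ_{m+n}) of nonnegative integers satisfying μ_1 ≥ μ_2 ≥ … ≥ μ_m, μ_{m+1} ≥ μ_{m+2} ≥ … ≥ μ_{m+n}, and μ_m ≥ #{i : m+1 ≤ i ≤ m+n and μ_i > 0}. -/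
/-- the map `λ ↦ Λ^λ = (λ_1,…,λ_m, max(0,λ'_1-m),…,max(0,λ'_n-m))`
is a bijection from the set of partitions satisfying the `(m|n)`-hook condition
`λ_{m+1} ≤ n` onto the set of tuples `(μ_1,…,μ_{m+n})` of nonnegative integers
with `μ_1 ≥ … ≥ μ_m`, `μ_{m+1} ≥ … ≥ μ_{m+n}`, and
`μ_m ≥ #{i : m+1 ≤ i ≤ m+n, μ_i > 0}`.

Partitions are encoded as Young diagrams; `λ_i = rowLen λ (i-1)` and
`λ'_i = colLen λ (i-1)` (1-based), and tuples are encoded as functions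
`Fin (m+n) → ℕ` (0-based); note `max (0, λ'_i - m)` is truncated subtraction. -/
theorem hook_highest_weight_bijection (m n : ℕ) (hm : 0 < m) (hn : 0 < n) :
    Set.BijOn
      (fun lam : YoungDiagram => fun i : Fin (m+n) =>
        if i.val < m then lam.rowLen i.val else lam.colLen (i.val - m) - m)
      {lam : YoungDiagram | lam.rowLen m ≤ n}
      {mu : Fin (m+n) → ℕ |
        (∀ i j : Fin (m+n), i ≤ j → j.val < m → mu j ≤ mu i) ∧
        (∀ i j : Fin (m+n), m ≤ i.val → i ≤ j → mu j ≤ mu i) ∧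
        ((Finset.univ.filter fun i : Fin (m+n) => m ≤ i.val ∧ 0 < mu i).card
          ≤ mu ⟨m-1, by omega⟩)} := by
  refine ⟨?_, ?_, ?_⟩
  · intro lam hlam
    simp only [Set.mem_setOf_eq] at hlam ⊢
    refine ⟨?_, ?_, ?_⟩
    · intro i j hij hj
      have hij' : i.val ≤ j.val := hij
      rw [if_pos hj, if_pos (by omega)]
      exact lam.rowLen_anti _ _ hij'
    · intro i j hi hij
      have hij' : i.val ≤ j.val := hij
      rw [if_neg (by omega), if_neg (by omega)]
      have := lam.colLen_anti (i.val - m) (j.val - m) (by omega)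
      omega
    · rw [if_pos (by omega)]
      rw [← Finset.card_range (lam.rowLen (m - 1))]
      apply Finset.card_le_card_of_injOn (fun i : Fin (m+n) => i.val - m)
      · intro i hi
        simp only [Finset.coe_filter, Finset.mem_univ, true_and, Set.mem_setOf_eq] at hi
        obtain ⟨h1, h2⟩ := hi
        rw [if_neg (by omega)] at h2
        have h3 : (m, i.val - m) ∈ lam := YoungDiagram.mem_iff_lt_colLen.2 (by omega)
        have h4 := YoungDiagram.mem_iff_lt_rowLen.1 h3
        have h5 := lam.rowLen_anti (m - 1) m (by omega)
        simp only [Finset.coe_range, Set.mem_Iio]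
        omega
      · intro i hi j hj hij
        simp only [Finset.coe_filter, Finset.mem_univ, true_and, Set.mem_setOf_eq] at hi hj hij
        apply Fin.ext
        omega
  · have key : ∀ a b : YoungDiagram, a.rowLen m ≤ n →
        ((fun i : Fin (m+n) => if i.val < m then a.rowLen i.val else a.colLen (i.val - m) - m) =
        (fun i : Fin (m+n) => if i.val < m then b.rowLen i.val else b.colLen (i.val - m) - m)) →
        ∀ i j : ℕ, (i, j) ∈ a → (i, j) ∈ b := by
      intro a b ha hab i j hij
      by_cases hi : i < m
      · have h := congrFun hab ⟨i, by omega⟩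
        simp only [hi, if_true] at h
        rw [YoungDiagram.mem_iff_lt_rowLen] at hij ⊢
        omega
      · have h1 : (m, j) ∈ a := a.up_left_mem (by omega) le_rfl hij
        have h2 := YoungDiagram.mem_iff_lt_rowLen.1 h1
        have h := congrFun hab ⟨m + j, by omega⟩
        simp only [show ¬ (m + j < m) by omega, if_false, Nat.add_sub_cancel_left] at h
        rw [YoungDiagram.mem_iff_lt_colLen] at hij ⊢
        omega
    intro a ha b hb hab
    apply YoungDiagram.ext
    ext ⟨i, j⟩
    exact ⟨key a b ha hab i j, key b a hb hab.symm i j⟩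
  · rintro mu ⟨h1, h2, h3⟩
    obtain ⟨g, hg⟩ : ∃ g : ℕ → ℕ, ∀ i : Fin (m+n), mu i = g i.val :=
      ⟨fun k => if h : k < m + n then mu ⟨k, h⟩ else 0, fun i => by simp⟩
    have g1 : ∀ i j, i ≤ j → j < m → g j ≤ g i := by
      intro i j hij hj
      have := h1 ⟨i, by omega⟩ ⟨j, by omega⟩ hij hj
      simpa only [hg] using this
    have g2 : ∀ i j, i ≤ j → j < n → g (m + j) ≤ g (m + i) := by
      intro i j hij hj
      have := h2 ⟨m + i, by omega⟩ ⟨m + j, by omega⟩ (by simp) (by simpa using hij)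
      simpa only [hg] using this
    have g3 : ∀ j, j < n → 0 < g (m + j) → j < g (m - 1) := by
      intro j hj hpos
      simp only [hg] at h3
      refine lt_of_lt_of_le ?_ h3
      rw [Nat.lt_iff_add_one_le]
      conv_lhs => rw [← Fintype.card_fin (j + 1), ← Finset.card_univ]
      apply Finset.card_le_card_of_injOn
        (fun k : Fin (j + 1) => (⟨m + k.val, by omega⟩ : Fin (m + n)))
      · intro k _
        have := g2 k.val j (by omega) hj
        simp only [Finset.coe_filter, Finset.mem_univ, true_and, Set.mem_setOf_eq]
        omega
      · intro k _ l _ hkl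
        simp only [Fin.mk.injEq] at hkl
        apply Fin.ext
        omega
    classical
    let P : ℕ × ℕ → Prop := fun c =>
      (c.1 < m ∧ c.2 < g c.1) ∨ (m ≤ c.1 ∧ c.2 < n ∧ c.1 < m + g (m + c.2))
    let lam : YoungDiagram :=
      { cells := ((Finset.range (m + g m)) ×ˢ (Finset.range (g 0 + n))).filter P
        isLowerSet := by
          rintro ⟨i, j⟩ ⟨a, b⟩ hle hmem
          obtain ⟨hai, hbj⟩ := Prod.mk_le_mk.1 hle
          simp only [Finset.coe_filter, Finset.mem_product, Finset.mem_range,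
            Set.mem_setOf_eq, P] at hmem ⊢
          obtain ⟨⟨hi, hj⟩, hP⟩ := hmem
          refine ⟨⟨by omega, by omega⟩, ?_⟩
          rcases hP with ⟨p, q⟩ | ⟨p, q, r⟩
          · have := g1 a i hai p
            left; omega
          · by_cases ham : a < m
            · have := g3 j q (by omega)
              have := g1 a (m - 1) (by omega) (by omega)
              left; omega
            · have := g2 b j hbj q
              right; omega }
    have hmem : ∀ i j, (i, j) ∈ lam ↔ P (i, j) := by
      intro i j
      rw [← YoungDiagram.mem_cells]
      simp only [lam, Finset.mem_filter, Finset.mem_product, Finset.mem_range, P]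
      refine ⟨fun h => h.2, fun h => ⟨?_, h⟩⟩
      rcases h with ⟨p, q⟩ | ⟨p, q, r⟩
      · have := g1 0 i (by omega) p
        omega
      · have := g2 0 j (by omega) q
        simp only [Nat.add_zero] at this
        omega
    refine ⟨lam, ?_, ?_⟩
    · simp only [Set.mem_setOf_eq]
      by_contra hc
      have := (hmem m n).1 (YoungDiagram.mem_iff_lt_rowLen.2 (by omega))
      simp only [P] at this
      omega
    · funext i
      simp only [hg]
      split_ifs with hi
      · apply eq_of_forall_lt_iff
        intro j
        rw [← YoungDiagram.mem_iff_lt_rowLen, hmem]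
        simp only [P]
        omega
      · apply eq_of_forall_lt_iff
        intro j
        have h := hmem (m + j) (i.val - m)
        rw [YoungDiagram.mem_iff_lt_colLen] at h
        simp only [P, show m + (i.val - m) = i.val by omega] at h
        have := i.isLt
        omega
end

section
/- For every positive integer p, the following identity holds in ℚ[[x_1,…,x_m,y_1,…,y_n]]: Σ_{λ∈H, λ_1≤p} s_λ(x|y) = (Σ_{ν∈H} s_ν(x|y)) · (Σ_{σ∈H_p} (−1)^{(|σ|−r(σ)(p−1))/2} s_σ(x|y)), where the left-hand sum runs over all (m|n)-hook partitions of width at most p, the first right-hand sum over all (m|n)-hook partitions, and the second over all (m|n)-hook partitions σ whose Frobenius arm and leg lengths satisfy a_k = b_k + p for all k = 1,…,r(σ). -/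
noncomputable section

/-- A skew semistandard Young tableau of shape `lam/tau` with entries in
`{0,…,m-1}` (representing the variables `x_1,…,x_m`): entries are `< m` on the
cells of `lam \ tau`, rows are weakly increasing, columns are strictly
increasing, and the tableau vanishes outside the skew shape. -/
def IsSkewSSYT (m : ℕ) (lam tau : YoungDiagram) (T : ℕ → ℕ → ℕ) : Prop :=
  (∀ i j : ℕ, (i, j) ∈ lam.cells \ tau.cells → T i j < m) ∧
  (∀ i j1 j2 : ℕ, j1 ≤ j2 → (i, j1) ∈ lam.cells \ tau.cells →
      (i, j2) ∈ lam.cells \ tau.cells → T i j1 ≤ T i j2) ∧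
  (∀ i1 i2 j : ℕ, i1 < i2 → (i1, j) ∈ lam.cells \ tau.cells →
      (i2, j) ∈ lam.cells \ tau.cells → T i1 j < T i2 j) ∧
  (∀ i j : ℕ, (i, j) ∉ lam.cells \ tau.cells → T i j = 0)

/-- The coefficient of the monomial `d` in the supersymmetric Schur function
`s_lam(x|y) = Σ_{τ ⊆ lam} s_{lam/τ}(x) s_{τ'}(y)`: the number of triples
`(τ, T_x, T_y)` where `τ ⊆ lam`, `T_x` is a skew SSYT of shape `lam/τ` in the
`x`-alphabet with content `d ∘ inl`, and `T_y` is an SSYT of shape `τ'` in the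
`y`-alphabet with content `d ∘ inr`. -/
def superSchurCoeff (m n : ℕ) (lam : YoungDiagram) (d : (Fin m ⊕ Fin n) →₀ ℕ) : ℕ :=
  Set.ncard {t : YoungDiagram × (ℕ → ℕ → ℕ) × (ℕ → ℕ → ℕ) |
    t.1 ≤ lam ∧ IsSkewSSYT m lam t.1 t.2.1 ∧
    IsSkewSSYT n t.1.transpose ⊥ t.2.2 ∧
    (∀ k : Fin m, d (Sum.inl k)
        = ((lam.cells \ t.1.cells).filter fun c => t.2.1 c.1 c.2 = k.val).card) ∧
    (∀ k : Fin n, d (Sum.inr k)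
        = ((t.1.transpose.cells \ (⊥ : YoungDiagram).cells).filter
            fun c => t.2.2 c.1 c.2 = k.val).card)}

/-- The supersymmetric Schur function `s_lam(x|y)` as a formal power series in
`x_1,…,x_m, y_1,…,y_n`. -/
def superSchur (m n : ℕ) (lam : YoungDiagram) : MvPowerSeries (Fin m ⊕ Fin n) ℚ :=
  fun d => (superSchurCoeff m n lam d : ℚ)

/-- The coefficientwise sum `Σ_{lam ∈ S} c(lam) · s_lam(x|y)` of supersymmetric
Schur functions over a set `S` of partitions with coefficients `c`; it is well
defined coefficientwise since only finitely many partitions contribute to a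
given coefficient. -/
def superSchurSum (m n : ℕ) (S : Set YoungDiagram) (c : YoungDiagram → ℚ) :
    MvPowerSeries (Fin m ⊕ Fin n) ℚ :=
  fun d => ∑' lam : S, c lam * (superSchurCoeff m n (lam : YoungDiagram) d : ℚ)


/-- The Frobenius rank of a partition: the number of diagonal cells. -/
def frobRank (lam : YoungDiagram) : ℕ :=
  (lam.cells.filter fun c => c.1 = c.2).card

/-- The set `P_p` of partitions whose Frobenius arm and leg lengths satisfy
`a_k = b_k + p` for `k = 1,…,r(σ)`; equivalently `σ_k = σ'_k + p` for all
`k ≤ r(σ)` (0-based: `rowLen σ k = colLen σ k + p` for all `k < r(σ)`). -/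
def frobSet (p : ℕ) : Set YoungDiagram :=
  {lam | ∀ k < frobRank lam, lam.rowLen k = lam.colLen k + p}

namespace HWF
open Finset

/-! ### Young diagrams -/

/-- Young diagram with prescribed row lengths. -/
def ydOf (f : ℕ → ℕ) (hf : Antitone f) (N : ℕ) (_hN : f N = 0) : YoungDiagram where
  cells := (range N ×ˢ range (f 0)).filter (fun c => c.2 < f c.1)
  isLowerSet := by
    rintro ⟨i, j⟩ ⟨i', j'⟩ hle hmem
    obtain ⟨h1, h2⟩ := Prod.mk_le_mk.1 hle
    simp only [coe_filter, mem_product, mem_range, Set.mem_ofPred_eq] at hmem ⊢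
    have := hf h1
    have := hf (Nat.zero_le i')
    refine ⟨⟨?_, ?_⟩, ?_⟩ <;> omega

lemma mem_ydOf {f : ℕ → ℕ} {hf : Antitone f} {N : ℕ} {hN : f N = 0} {i j : ℕ} :
    (i, j) ∈ ydOf f hf N hN ↔ j < f i := by
  rw [← YoungDiagram.mem_cells]
  simp only [ydOf, mem_filter, mem_product, mem_range]
  constructor
  · rintro ⟨_, h⟩; exact h
  · intro h
    have h0 := hf (Nat.zero_le i)
    refine ⟨⟨?_, by omega⟩, h⟩
    by_contra hc
    have := hf (not_lt.1 hc)
    omega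

lemma rowLen_eq_of_mem {l : YoungDiagram} {i k : ℕ} (h : ∀ j, (i, j) ∈ l ↔ j < k) :
    l.rowLen i = k := by
  have h1 := h k
  have h2 := h (l.rowLen i)
  rw [YoungDiagram.mem_iff_lt_rowLen] at h1 h2
  omega

lemma rowLen_ydOf {f : ℕ → ℕ} {hf : Antitone f} {N : ℕ} {hN : f N = 0} {i : ℕ} :
    (ydOf f hf N hN).rowLen i = f i := rowLen_eq_of_mem fun _ => mem_ydOf

lemma yd_le_iff {l m : YoungDiagram} : m ≤ l ↔ ∀ i, m.rowLen i ≤ l.rowLen i := by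
  constructor
  · intro h i
    by_contra hc
    have : (i, l.rowLen i) ∈ m := YoungDiagram.mem_iff_lt_rowLen.2 (by omega)
    have := YoungDiagram.mem_iff_lt_rowLen.1 (h this)
    omega
  · rintro h ⟨i, j⟩ hm
    have := YoungDiagram.mem_iff_lt_rowLen.1 hm
    have := h i
    exact YoungDiagram.mem_iff_lt_rowLen.2 (by omega)

lemma yd_ext {l m : YoungDiagram} (h : ∀ i, l.rowLen i = m.rowLen i) : l = m :=
  le_antisymm (yd_le_iff.2 fun i => (h i).le) (yd_le_iff.2 fun i => (h i).ge)

lemma rowLen_zero_of_le {l : YoungDiagram} {N i : ℕ} (h : l.rowLen N = 0) (hi : N ≤ i) :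
    l.rowLen i = 0 := by
  have := l.rowLen_anti _ _ hi
  omega

lemma yd_ext_fin {N : ℕ} {l m : YoungDiagram} (hl : l.rowLen N = 0) (hm : m.rowLen N = 0)
    (h : ∀ i : Fin N, l.rowLen i = m.rowLen i) : l = m := by
  apply yd_ext
  intro i
  by_cases hi : i < N
  · exact h ⟨i, hi⟩
  · rw [rowLen_zero_of_le hl (by omega), rowLen_zero_of_le hm (by omega)]

lemma exists_yd {N : ℕ} (f : Fin N → ℕ) (hf : Antitone f) :
    ∃ l : YoungDiagram, l.rowLen N = 0 ∧ ∀ i : Fin N, l.rowLen i = f i := by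
  have ha : Antitone (fun i : ℕ => if h : i < N then f ⟨i, h⟩ else 0) := by
    intro i j hij
    dsimp only
    split_ifs with h1 h2
    · exact hf (by simpa using hij)
    · omega
    · exact Nat.zero_le _
    · exact Nat.zero_le _
  refine ⟨ydOf _ ha N (by simp), ?_, ?_⟩
  · rw [rowLen_ydOf]; simp
  · intro i; rw [rowLen_ydOf]; simp

lemma card_eq_sum_rowLen {N : ℕ} {l : YoungDiagram} (h : l.rowLen N = 0) :
    l.cells.card = ∑ i : Fin N, l.rowLen i := by
  rw [Fin.sum_univ_eq_sum_range (fun i => l.rowLen i) N]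
  rw [Finset.card_eq_sum_card_fiberwise (f := Prod.fst) (t := range N)]
  · refine Finset.sum_congr rfl fun i _ => ?_
    rw [YoungDiagram.rowLen_eq_card]
    rfl
  · rintro ⟨i, j⟩ hc
    simp only [coe_range, Set.mem_Iio]
    have h1 : (i, j) ∈ l := hc
    rw [YoungDiagram.mem_iff_lt_rowLen] at h1
    by_contra hh
    rw [rowLen_zero_of_le h (by omega)] at h1
    omega

lemma rowLen_card (l : YoungDiagram) : l.rowLen l.cells.card = 0 := by
  by_contra hc
  have h1 : (l.cells.card, 0) ∈ l := YoungDiagram.mem_iff_lt_rowLen.2 (by omega)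
  have h2 : (range (l.cells.card + 1)).image (fun i => ((i, 0) : ℕ × ℕ)) ⊆ l.cells := by
    intro c hc
    simp only [mem_image, mem_range] at hc
    obtain ⟨i, hi, rfl⟩ := hc
    exact l.up_left_mem (by omega) le_rfl h1
  have h3 := card_le_card h2
  rw [card_image_of_injective _ (fun a b h => by simpa using h)] at h3
  simp at h3

lemma finite_below (l : YoungDiagram) : {m : YoungDiagram | m ≤ l}.Finite := by
  apply Set.Finite.of_finite_image (f := YoungDiagram.cells)
  · apply (l.cells.powerset.finite_toSet).subset
    rintro _ ⟨m, hm, rfl⟩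
    simpa using hm
  · intro a _ b _ h
    exact YoungDiagram.ext h

/-- Diagrams contained in a given one. -/
def below (l : YoungDiagram) : Finset YoungDiagram := (finite_below l).toFinset

@[simp] lemma mem_below {l m : YoungDiagram} : m ∈ below l ↔ m ≤ l := by simp [below]

lemma finite_parts (d : ℕ) : {m : YoungDiagram | m.cells.card = d}.Finite := by
  apply Set.Finite.of_finite_image (f := YoungDiagram.cells)
  · apply ((range (d + 1) ×ˢ range (d + 1)).powerset.finite_toSet).subset
    rintro _ ⟨m, hm, rfl⟩
    simp only [Set.mem_ofPred_eq] at hm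
    simp only [coe_powerset, Set.mem_preimage, Set.mem_powerset_iff, coe_subset]
    rintro ⟨i, j⟩ hc
    have hc' : (i, j) ∈ m := hc
    simp only [mem_product, mem_range]
    constructor
    · by_contra hh
      have h1 := YoungDiagram.mem_iff_lt_rowLen.1 hc'
      rw [rowLen_zero_of_le (rowLen_card m) (by omega)] at h1
      omega
    · have h1 := YoungDiagram.mem_iff_lt_rowLen.1 hc'
      have h2 : m.row i ⊆ m.cells := filter_subset _ _
      have := card_le_card h2
      rw [← YoungDiagram.rowLen_eq_card] at this
      omega
  · intro a _ b _ h
    exact YoungDiagram.ext h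

/-- Partitions of a given size. -/
def parts (d : ℕ) : Finset YoungDiagram := (finite_parts d).toFinset

@[simp] lemma mem_parts {d : ℕ} {m : YoungDiagram} : m ∈ parts d ↔ m.cells.card = d := by
  simp [parts]

/-- Horizontal strips. -/
def HS (l m : YoungDiagram) : Prop := m ≤ l ∧ ∀ i j, (i + 1, j) ∈ l → (i, j) ∈ m

/-- Vertical strips. -/
def VS (l m : YoungDiagram) : Prop := m ≤ l ∧ ∀ i j, (i, j + 1) ∈ l → (i, j) ∈ m

lemma HS_iff {l m : YoungDiagram} :
    HS l m ↔ ∀ i, m.rowLen i ≤ l.rowLen i ∧ l.rowLen (i + 1) ≤ m.rowLen i := by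
  unfold HS
  rw [yd_le_iff]
  simp only [YoungDiagram.mem_iff_lt_rowLen]
  constructor
  · rintro ⟨h1, h2⟩ i
    refine ⟨h1 i, ?_⟩
    by_contra hc
    have := h2 i (m.rowLen i) (by omega)
    omega
  · intro h
    exact ⟨fun i => (h i).1, fun i j hj => lt_of_lt_of_le hj (h i).2⟩

lemma VS_iff {l m : YoungDiagram} :
    VS l m ↔ ∀ i, m.rowLen i ≤ l.rowLen i ∧ l.rowLen i ≤ m.rowLen i + 1 := by
  unfold VS
  rw [yd_le_iff]
  simp only [YoungDiagram.mem_iff_lt_rowLen]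
  constructor
  · rintro ⟨h1, h2⟩ i
    refine ⟨h1 i, ?_⟩
    by_contra hc
    have := h2 i (m.rowLen i) (by omega)
    omega
  · intro h
    exact ⟨fun i => (h i).1, fun i j hj => by have := (h i).2; omega⟩

lemma HS_transpose {l m : YoungDiagram} : HS l.transpose m.transpose ↔ VS l m := by
  unfold HS VS
  rw [YoungDiagram.transpose_le_iff]
  simp only [YoungDiagram.mem_transpose, Prod.swap_prod_mk]
  constructor
  · rintro ⟨h1, h2⟩; exact ⟨h1, fun i j => h2 j i⟩
  · rintro ⟨h1, h2⟩; exact ⟨h1, fun i j => h2 j i⟩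

end HWF

namespace HWF
open Finset

variable {R : Type*} [CommRing R]

/-- Extension of a sequence by zero to negative indices. -/
def hz (h : ℕ → R) (z : ℤ) : R := if 0 ≤ z then h z.toNat else 0

lemma hz_neg {h : ℕ → R} {z : ℤ} (hz' : z < 0) : hz h z = 0 := by
  unfold hz; rw [if_neg (by omega)]

lemma hz_nat (h : ℕ → R) (k : ℕ) : hz h k = h k := by simp [hz]

/-- Jacobi-Trudi determinant. -/
def JT (N : ℕ) (h : ℕ → R) (a : Fin N → ℤ) : R :=
  Matrix.det (Matrix.of fun i j : Fin N => hz h (a i + (j : ℕ)))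

/-- Shifted rows. -/
def ya (N : ℕ) (l : YoungDiagram) (i : Fin N) : ℤ := (l.rowLen i : ℤ) - (i : ℕ)

/-- Jacobi-Trudi determinant of a partition. -/
def sN (N : ℕ) (h : ℕ → R) (l : YoungDiagram) : R := JT N h (ya N l)

lemma ya_strictAnti (N : ℕ) (l : YoungDiagram) : StrictAnti (ya N l) := by
  intro i j hij
  have := l.rowLen_anti i j (by exact_mod_cast hij.le)
  have h2 : (i : ℕ) < j := hij
  unfold ya
  omega

lemma JT_eq_zero_of_eq {N : ℕ} {h : ℕ → R} {a : Fin N → ℤ} {i j : Fin N} (hij : i ≠ j)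
    (e : a i = a j) : JT N h a = 0 := by
  unfold JT
  apply Matrix.det_zero_of_row_eq hij
  funext k
  simp [e]

lemma JT_eq_zero_of_lt {N : ℕ} {h : ℕ → R} {a : Fin N → ℤ} {i : Fin N}
    (e : a i ≤ -N) : JT N h a = 0 := by
  unfold JT
  apply Matrix.det_eq_zero_of_row_eq_zero i
  intro j
  simp only [Matrix.of_apply]
  apply hz_neg
  have := j.2
  omega

lemma JT_map {S : Type*} [CommRing S] (f : R →+* S) (N : ℕ) (h : ℕ → R) (a : Fin N → ℤ) :
    f (JT N h a) = JT N (fun k => f (h k)) a := by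
  unfold JT
  rw [RingHom.map_det]
  congr 1
  ext i j
  simp only [RingHom.mapMatrix_apply, Matrix.map_apply, Matrix.of_apply, hz]
  split_ifs <;> simp

lemma sN_map {S : Type*} [CommRing S] (f : R →+* S) (N : ℕ) (h : ℕ → R) (l : YoungDiagram) :
    f (sN N h l) = sN N (fun k => f (h k)) l := JT_map f N h _

lemma JT_vertical (N : ℕ) (h h' : ℕ → R) (y : R)
    (hh : ∀ z, hz h' z = hz h z + y * hz h (z - 1)) (a : Fin N → ℤ) :
    JT N h' a = ∑ s : Finset (Fin N), y ^ s.card *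
      JT N h (fun i => a i - if i ∈ s then 1 else 0) := by
  have h1 : (Matrix.of fun i j : Fin N => hz h' (a i + (j : ℕ))) =
      (fun i => y • fun j : Fin N => hz h (a i - 1 + (j : ℕ))) +
      (fun i => fun j : Fin N => hz h (a i + (j : ℕ))) := by
    ext i j
    simp only [Matrix.of_apply, hh, Pi.add_apply, Pi.smul_apply, smul_eq_mul]
    rw [add_comm]
    congr 3
    ring
  unfold JT
  rw [h1]
  change (Matrix.detRowAlternating (R := R) (n := Fin N)).toMultilinearMap (_ + _) = _
  rw [MultilinearMap.map_add_univ]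
  refine Finset.sum_congr rfl fun s _ => ?_
  have h2 : s.piecewise (fun i => y • fun j : Fin N => hz h (a i - 1 + (j : ℕ)))
      (fun i => fun j : Fin N => hz h (a i + (j : ℕ))) =
      s.piecewise (fun i => y • (fun j : Fin N => hz h (a i - (if i ∈ s then 1 else 0) + (j : ℕ))))
        (fun i => (fun j : Fin N => hz h (a i - (if i ∈ s then 1 else 0) + (j : ℕ)))) := by
    ext i j
    by_cases hi : i ∈ s <;> simp [hi]
  rw [h2, MultilinearMap.map_piecewise_smul _ (fun _ => y)]
  rw [Finset.prod_const, smul_eq_mul]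
  rfl

open scoped Classical in
lemma sN_vertical {N : ℕ} {h h' : ℕ → R} {y : R}
    (hh : ∀ z, hz h' z = hz h z + y * hz h (z - 1)) {l : YoungDiagram} (hl : l.rowLen N = 0) :
    sN N h' l = ∑ m ∈ (below l).filter (fun m => VS l m),
      y ^ (l.cells.card - m.cells.card) * sN N h m := by

  unfold sN
  rw [JT_vertical N h h' y hh]
  symm
  have hN : ∀ m, VS l m → m.rowLen N = 0 := fun m hm => by
    have := (VS_iff.1 hm N).1
    omega
  refine Finset.sum_of_injOn (fun m => univ.filter fun i : Fin N => m.rowLen i < l.rowLen i)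
    ?_ (by intro; simp) ?_ ?_
  · intro m hm m' hm' he
    simp only [coe_filter, mem_below, Set.mem_ofPred_eq] at hm hm'
    refine yd_ext_fin (hN m hm.2) (hN m' hm'.2) fun i => ?_
    have h1 := congrArg (fun s => i ∈ s) he
    simp only [mem_filter, mem_univ, true_and, eq_iff_iff] at h1
    have h2 := VS_iff.1 hm.2 i
    have h3 := VS_iff.1 hm'.2 i
    omega
  · intro s _ hs
    by_contra hne
    have hne' : JT N h (fun i => ya N l i - if i ∈ s then 1 else 0) ≠ 0 :=
      fun h0 => hne (by rw [h0, mul_zero])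
    apply hs
    have hpos : ∀ i ∈ s, 1 ≤ l.rowLen i := by
      intro i hi
      by_contra hc
      apply hne'
      have hN0 : 0 < N := i.pos
      by_cases hlast : (i : ℕ) + 1 = N
      · apply JT_eq_zero_of_lt (i := i)
        simp only [ya, hi, if_true]
        omega
      · -- the set is eventually in s
        have key : ∀ k : ℕ, ∀ hk : k < N, (i : ℕ) ≤ k → (⟨k, hk⟩ : Fin N) ∈ s := by
          intro k hk hik
          induction k, hik using Nat.le_induction with
          | base => exact hi
          | succ k hik ih =>
            have ih' := ih (by omega)
            by_contra hns
            apply hne'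
            apply JT_eq_zero_of_eq (i := ⟨k, by omega⟩) (j := ⟨k + 1, hk⟩)
            · simp
            · simp only [ya, ih', hns, if_true, if_false]
              have h1 := l.rowLen_anti _ _ hik
              have h2 := l.rowLen_anti k (k + 1) (Nat.le_succ k)
              push_cast
              omega
        apply JT_eq_zero_of_lt (i := ⟨N - 1, by omega⟩)
        have := key (N - 1) (by omega) (by omega)
        have h1 := l.rowLen_anti i (N - 1) (by omega)
        simp only [ya, this, if_true]
        omega
    have hanti : Antitone (fun i : Fin N => l.rowLen i - if i ∈ s then 1 else 0) := by
      intro i j hij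
      rcases eq_or_lt_of_le hij with rfl | hlt
      · rfl
      · obtain ⟨k, rfl⟩ : ∃ k, N = k + 1 := ⟨N - 1, by have := i.pos; omega⟩
        have := l.rowLen_anti i j hij
        by_contra hc
        simp only [not_le] at hc
        -- reduces to consecutive rows
        have hi : i ∈ s := by
          by_contra hh
          simp only [hh, if_false] at hc
          split_ifs at hc <;> omega
        have hj : j ∉ s := by
          intro hh
          simp only [hh, hi, if_true] at hc
          omega
        simp only [hi, hj, if_true, if_false] at hc
        have hconst : ∀ q : ℕ, (i : ℕ) ≤ q → q ≤ j → l.rowLen q = l.rowLen i := by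
          intro q h1 h2
          have e1 := l.rowLen_anti _ _ h1
          have e2 := l.rowLen_anti _ _ h2
          omega
        have key : ∀ q : ℕ, ∀ hq : q < k + 1, (i : ℕ) ≤ q → q ≤ j → (⟨q, hq⟩ : Fin (k + 1)) ∈ s := by
          intro q hq h1
          induction q, h1 using Nat.le_induction with
          | base => intro; exact hi
          | succ q h1 ih =>
            intro h2
            have ih' := ih (by omega) (by omega)
            by_contra hns
            apply hne'
            apply JT_eq_zero_of_eq (i := ⟨q, by omega⟩) (j := ⟨q + 1, hq⟩)
            · simp
            · simp only [ya, ih', hns, if_true, if_false]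
              rw [hconst q h1 (by omega), hconst (q + 1) (by omega) h2]
              push_cast
              ring
        exact hj (key j j.2 hij le_rfl)
    obtain ⟨m, hm0, hm⟩ := exists_yd _ hanti
    have hvs : VS l m := by
      rw [VS_iff]
      intro i
      by_cases hi : i < N
      · have := hm ⟨i, hi⟩
        simp only at this
        rw [this]
        split_ifs <;> omega
      · rw [rowLen_zero_of_le hm0 (by omega), rowLen_zero_of_le hl (by omega)]
        omega
    refine ⟨m, ?_, ?_⟩
    · simpa using ⟨hvs.1, hvs⟩
    · ext i
      simp only [mem_filter, mem_univ, true_and, hm]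
      by_cases hi : i ∈ s
      · have := hpos i hi
        simp only [hi, if_true, iff_true]; omega
      · simp [hi]
  · intro m hm
    simp only [mem_filter, mem_below] at hm
    have h1 := fun i => VS_iff.1 hm.2 i
    congr 1
    · congr 1
      rw [card_eq_sum_rowLen hl, card_eq_sum_rowLen (hN m hm.2), Finset.card_filter]
      rw [← Finset.sum_tsub_distrib (f := fun i : Fin N => l.rowLen i)
        (g := fun i : Fin N => m.rowLen i) univ (fun i _ => (h1 i).1)]
      refine Finset.sum_congr rfl fun i _ => ?_
      have := h1 i
      split_ifs <;> omega
    · congr 1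
      funext i
      have := h1 i
      simp only [ya, mem_filter, mem_univ, true_and]
      split_ifs <;> omega

lemma hz_expand {h h' : ℕ → R} {x : R}
    (hh : ∀ z, hz h' z = hz h z + x * hz h' (z - 1)) (z : ℤ) (K : ℕ) :
    hz h' z = (∑ k ∈ range K, x ^ k * hz h (z - k)) + x ^ K * hz h' (z - K) := by
  induction K with
  | zero => simp
  | succ K ih =>
    rw [ih, Finset.sum_range_succ, hh (z - K)]
    push_cast
    rw [show z - K - 1 = z - ((K : ℤ) + 1) by ring]
    ring

open scoped Classical in
lemma sN_horizontal {N : ℕ} {h h' : ℕ → R} {x : R}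
    (hh : ∀ z, hz h' z = hz h z + x * hz h' (z - 1)) {l : YoungDiagram} (hl : l.rowLen N = 0) :
    sN N h' l = ∑ m ∈ (below l).filter (fun m => HS l m),
      x ^ (l.cells.card - m.cells.card) * sN N h m := by

  -- row reduction
  have h1 : sN N h' l = Matrix.det (fun i j : Fin N =>
      ∑ k ∈ range (l.rowLen i - l.rowLen (i + 1) + 1),
        x ^ k * hz h (ya N l i - k + (j : ℕ))) := by
    let U : Matrix (Fin N) (Fin N) R := fun i j =>
      if i = j then 1 else if (i : ℕ) + 1 = j then - x ^ (l.rowLen i - l.rowLen (i + 1) + 1) else 0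
    have hU : U.det = 1 := by
      rw [Matrix.det_of_isUpperTriangular]
      · simp [U]
      · intro i j hij
        have hij' : (j : ℕ) < i := hij
        simp only [U]
        rw [if_neg (by intro e; subst e; omega), if_neg (by omega)]
    unfold sN JT
    rw [← one_mul (Matrix.det _), ← hU, ← Matrix.det_mul]
    congr 1
    ext i j
    simp only [Matrix.mul_apply, Matrix.of_apply]
    have hanti := l.rowLen_anti i (i + 1) (by omega)
    have e1 := hz_expand hh (ya N l i + (j : ℕ)) (l.rowLen i - l.rowLen (i + 1) + 1)
    have e2 : ∑ k : Fin N, U i k * hz h' (ya N l k + (j : ℕ)) =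
        hz h' (ya N l i + (j : ℕ)) - x ^ (l.rowLen i - l.rowLen (i + 1) + 1) *
          hz h' (ya N l i + (j : ℕ) - (l.rowLen i - l.rowLen (i + 1) + 1 : ℕ)) := by
      by_cases hi : (i : ℕ) + 1 < N
      · rw [Finset.sum_eq_add i ⟨i + 1, hi⟩]
        · have : i ≠ ⟨i + 1, hi⟩ := by intro e; have := congrArg Fin.val e; simp at this
          simp only [U, if_true, this, if_false]
          rw [one_mul, neg_mul, ← sub_eq_add_neg]
          congr 3
          simp only [ya]
          push_cast [Nat.cast_sub hanti]
          ring
        · intro e; have := congrArg Fin.val e; simp at this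
        · intro k _ hk
          simp only [U]
          rw [if_neg (Ne.symm hk.1), if_neg, zero_mul]
          intro e
          exact hk.2 (Fin.ext e.symm)
        · simp
        · simp
      · rw [Finset.sum_eq_single i]
        · simp only [U, if_true]
          have hN : (i : ℕ) + 1 = N := by omega
          rw [hz_neg (z := ya N l i + (j : ℕ) - _)]
          · ring
          · simp only [ya, hN, hl]
            have := j.2
            push_cast
            omega
        · intro k _ hk
          simp only [U]
          rw [if_neg (Ne.symm hk), if_neg, zero_mul]
          intro e
          have := k.2
          omega
        · simp
    rw [e2, e1, add_sub_cancel_right]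
    refine Finset.sum_congr rfl fun k _ => ?_
    congr 2
    ring
  rw [h1]
  have h2 : (fun i j : Fin N =>
      ∑ k ∈ range (l.rowLen i - l.rowLen (i + 1) + 1),
        x ^ k * hz h (ya N l i - k + (j : ℕ))) = fun i : Fin N =>
      ∑ k ∈ range (l.rowLen i - l.rowLen (i + 1) + 1),
        x ^ k • fun j : Fin N => hz h (ya N l i - k + (j : ℕ)) := by
    ext i j
    rw [Finset.sum_apply]
    rfl
  rw [h2]
  change (Matrix.detRowAlternating (R := R) (n := Fin N)).toMultilinearMap _ = _
  rw [MultilinearMap.map_sum_finset]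
  symm
  have hN : ∀ m, HS l m → m.rowLen N = 0 := fun m hm => by
    have := (HS_iff.1 hm N).1
    omega
  refine Finset.sum_bij (fun m _ => fun i : Fin N => l.rowLen i - m.rowLen i) ?_ ?_ ?_ ?_
  · intro m hm
    simp only [mem_filter, mem_below] at hm
    simp only [Fintype.mem_piFinset, mem_range]
    intro i
    have := HS_iff.1 hm.2 i
    omega
  · intro m hm m' hm' he
    simp only [mem_filter, mem_below] at hm hm'
    refine yd_ext_fin (hN m hm.2) (hN m' hm'.2) fun i => ?_
    have e : l.rowLen i - m.rowLen i = l.rowLen i - m'.rowLen i := congrFun he i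
    have := HS_iff.1 hm.2 i
    have := HS_iff.1 hm'.2 i
    omega
  · intro r hr
    simp only [Fintype.mem_piFinset, mem_range] at hr
    have hanti : Antitone (fun i : Fin N => l.rowLen i - r i) := by
      intro i j hij
      rcases eq_or_lt_of_le hij with rfl | hlt
      · rfl
      · have e1 := hr i
        have e2 := l.rowLen_anti (i + 1) j hlt
        have e3 := l.rowLen_anti i (i + 1) (by omega)
        dsimp only
        omega
    obtain ⟨m, hm0, hm⟩ := exists_yd _ hanti
    have hhs : HS l m := by
      rw [HS_iff]
      intro i
      by_cases hi : i < N
      · have := hm ⟨i, hi⟩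
        have e1 := hr ⟨i, hi⟩
        have e3 := l.rowLen_anti i (i + 1) (by omega)
        simp only at this e1
        omega
      · rw [rowLen_zero_of_le hm0 (by omega), rowLen_zero_of_le hl (by omega),
          rowLen_zero_of_le hl (by omega)]
        omega
    refine ⟨m, ?_, ?_⟩
    · simpa using ⟨hhs.1, hhs⟩
    · funext i
      have e1 := hr i
      have := hm i
      have e3 := l.rowLen_anti i (i + 1) (by omega)
      omega
  · intro m hm
    simp only [mem_filter, mem_below] at hm
    have h1 := fun i => HS_iff.1 hm.2 i
    rw [MultilinearMap.map_smul_univ]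
    rw [smul_eq_mul, Finset.prod_pow_eq_pow_sum]
    congr 1
    · congr 1
      rw [card_eq_sum_rowLen hl, card_eq_sum_rowLen (hN m hm.2)]
      rw [← Finset.sum_tsub_distrib (f := fun i : Fin N => l.rowLen i)
        (g := fun i : Fin N => m.rowLen i) univ (fun i _ => (h1 i).1)]
    · unfold sN JT
      change Matrix.det _ = Matrix.det _
      congr 1
      ext i j
      simp only [Matrix.of_apply]
      congr 1
      have := h1 i
      simp only [ya]
      push_cast [Nat.cast_sub this.1]
      ring

end HWF

namespace HWF
open Finset

variable {R : Type*} [CommRing R]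

/-! ### Tableaux -/

lemma finite_tab (m : ℕ) (l t : YoungDiagram) : {T | IsSkewSSYT m l t T}.Finite := by
  apply Set.Finite.of_finite_image
    (f := fun (T : ℕ → ℕ → ℕ) (c : l.cells) => (Fin.ofNat (m + 1) (T c.1.1 c.1.2)))
  · exact Set.toFinite _
  · intro T hT T' hT' he
    obtain ⟨h1, -, -, h4⟩ := hT
    obtain ⟨h1', -, -, h4'⟩ := hT'
    funext i j
    by_cases hc : (i, j) ∈ l.cells \ t.cells
    · have e := congrFun he ⟨(i, j), (mem_sdiff.1 hc).1⟩
      have e' := congrArg Fin.val e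
      simp only [Fin.ofNat] at e'
      rwa [Nat.mod_eq_of_lt (by have := h1 i j hc; omega),
        Nat.mod_eq_of_lt (by have := h1' i j hc; omega)] at e'
    · rw [h4 i j hc, h4' i j hc]

/-- The finite set of tableaux. -/
def tset (m : ℕ) (l t : YoungDiagram) : Finset (ℕ → ℕ → ℕ) := (finite_tab m l t).toFinset

lemma mem_tset {m : ℕ} {l t : YoungDiagram} {T : ℕ → ℕ → ℕ} :
    T ∈ tset m l t ↔ IsSkewSSYT m l t T := by simp [tset]

/-- Skew Schur polynomial as a tableau sum. -/
def W (X : ℕ → R) (m : ℕ) (l t : YoungDiagram) : R :=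
  ∑ T ∈ tset m l t, ∏ c ∈ l.cells \ t.cells, X (T c.1 c.2)

open scoped Classical in
lemma W_zero (X : ℕ → R) {l t : YoungDiagram} (h : t ≤ l) :
    W X 0 l t = if t = l then 1 else 0 := by
  split_ifs with e
  · subst e
    have : tset 0 t t = {fun _ _ => 0} := by
      ext T
      rw [mem_tset, mem_singleton]
      have hn : ∀ i j, (i, j) ∉ t.cells \ t.cells := fun i j => by simp
      constructor
      · intro h; funext i j; exact h.2.2.2 i j (hn i j)
      · rintro rfl
        exact ⟨fun i j hc => absurd hc (hn i j), fun i j _ _ hc => absurd hc (hn i j),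
          fun i _ j _ hc => absurd hc (hn i j), fun _ _ _ => rfl⟩
    simp [W, this]
  · have : tset 0 l t = ∅ := by
      rw [eq_empty_iff_forall_notMem]
      intro T hT
      obtain ⟨h1, -⟩ := mem_tset.1 hT
      apply e
      apply le_antisymm h
      rintro ⟨i, j⟩ hc
      by_contra hh
      have := h1 i j (by simpa using ⟨hc, hh⟩)
      omega
    simp [W, this]

open scoped Classical in
lemma W_succ (X : ℕ → R) (m : ℕ) {l t : YoungDiagram} (h : t ≤ l) :
    W X (m + 1) l t = ∑ u ∈ (below l).filter (fun u => HS l u ∧ t ≤ u),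
      X m ^ (l.cells.card - u.cells.card) * W X m u t := by
  unfold W
  simp only [Finset.mul_sum]
  rw [Finset.sum_sigma']
  symm
  refine Finset.sum_bij
    (fun a _ => fun i j => if (i, j) ∈ l.cells \ a.1.cells then m else a.2 i j) ?_ ?_ ?_ ?_
  · rintro ⟨u, T⟩ ha
    simp only [mem_sigma, mem_filter, mem_below, mem_tset] at ha
    obtain ⟨⟨hul, hhs, htu⟩, h1, h2, h3, h4⟩ := ha
    simp only [mem_sdiff, YoungDiagram.mem_cells] at h1 h2 h3 h4
    rw [mem_tset]
    simp only [IsSkewSSYT, mem_sdiff, YoungDiagram.mem_cells]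
    refine ⟨?_, ?_, ?_, ?_⟩
    · rintro i j ⟨hc, hc'⟩
      split_ifs with hh
      · omega
      · have : (i, j) ∈ u := by tauto
        have := h1 i j ⟨this, hc'⟩
        omega
    · rintro i j1 j2 hj ⟨hc1, hc1'⟩ ⟨hc2, hc2'⟩
      by_cases hu1 : (i, j1) ∈ u
      · have e1 := h1 i j1 ⟨hu1, hc1'⟩
        by_cases hu2 : (i, j2) ∈ u
        · simp only [hu1, hu2, not_true, and_false, if_false]
          exact h2 i j1 j2 hj ⟨hu1, hc1'⟩ ⟨hu2, hc2'⟩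
        · simp only [hu1, hu2, hc2, not_true, and_false, if_false, not_false_eq_true, and_self,
            if_true]
          omega
      · have hu2 : (i, j2) ∉ u := fun hh => hu1 (u.up_left_mem le_rfl hj hh)
        simp [hu1, hu2, hc1, hc2]
    · rintro i1 i2 j hi ⟨hc1, hc1'⟩ ⟨hc2, hc2'⟩
      have hu1 : (i1, j) ∈ u := hhs.2 i1 j (l.up_left_mem (by omega) le_rfl hc2)
      have e1 := h1 i1 j ⟨hu1, hc1'⟩
      by_cases hu2 : (i2, j) ∈ u
      · simp only [hu1, hu2, not_true, and_false, if_false]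
        exact h3 i1 i2 j hi ⟨hu1, hc1'⟩ ⟨hu2, hc2'⟩
      · simp only [hu1, hu2, hc2, not_true, and_false, if_false, not_false_eq_true, and_self,
            if_true]
        omega
    · intro i j hc
      have e1 : ¬ ((i, j) ∈ l ∧ (i, j) ∉ u) := fun hh => hc ⟨hh.1, fun ht => hh.2 (htu ht)⟩
      rw [if_neg e1]
      exact h4 i j fun hh => hc ⟨hul hh.1, hh.2⟩
  · rintro ⟨u, T⟩ ha ⟨u', T'⟩ ha' he
    simp only [mem_sigma, mem_filter, mem_below, mem_tset] at ha ha'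
    obtain ⟨⟨hul, hhs, htu⟩, h1, -, -, h4⟩ := ha
    obtain ⟨⟨hul', hhs', htu'⟩, h1', -, -, h4'⟩ := ha'
    simp only [mem_sdiff, YoungDiagram.mem_cells] at h1 h4 h1' h4' he
    have he' := fun i j => congrFun (congrFun he i) j
    have huu : u = u' := by
      apply le_antisymm
      · rintro ⟨i, j⟩ hc
        by_contra hh
        have ht : (i, j) ∉ t := fun ht => hh (htu' ht)
        have e1 := h1 i j ⟨hc, ht⟩
        have e2 := he' i j
        have e3 : (i, j) ∈ u := hc
        have e4 : (i, j) ∉ u' := hh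
        have e5 : (i, j) ∈ l := hul hc
        simp only [e3, e4, e5, not_true, and_false, if_false, not_false_eq_true, and_self,
            if_true] at e2
        omega
      · rintro ⟨i, j⟩ hc
        by_contra hh
        have ht : (i, j) ∉ t := fun ht => hh (htu ht)
        have e1 := h1' i j ⟨hc, ht⟩
        have e2 := he' i j
        have e3 : (i, j) ∈ u' := hc
        have e4 : (i, j) ∉ u := hh
        have e5 : (i, j) ∈ l := hul' hc
        simp only [e3, e4, e5, not_true, and_false, if_false, not_false_eq_true, and_self,
            if_true] at e2
        omega
    subst huu
    have : T = T' := by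
      funext i j
      by_cases hc : (i, j) ∈ l ∧ (i, j) ∉ u
      · rw [h4 i j (by tauto), h4' i j (by tauto)]
      · have := he' i j
        rwa [if_neg hc, if_neg hc] at this
    rw [this]
  · intro T hT
    obtain ⟨h1, h2, h3, h4⟩ := mem_tset.1 hT
    simp only [mem_sdiff, YoungDiagram.mem_cells] at h1 h2 h3 h4
    let u : YoungDiagram :=
      { cells := l.cells.filter fun c => c ∈ t ∨ T c.1 c.2 < m
        isLowerSet := by
          rintro ⟨i, j⟩ ⟨i', j'⟩ hle hmem
          obtain ⟨hi, hj⟩ := Prod.mk_le_mk.1 hle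
          simp only [coe_filter, YoungDiagram.mem_cells, Set.mem_ofPred_eq] at hmem ⊢
          refine ⟨l.up_left_mem hi hj hmem.1, ?_⟩
          by_cases ht : (i', j') ∈ t
          · exact Or.inl ht
          · have ht2 : (i', j) ∉ t := fun hh => ht (t.up_left_mem le_rfl hj hh)
            have ht3 : (i, j) ∉ t := fun hh => ht (t.up_left_mem hi hj hh)
            have hl2 : (i', j) ∈ l := l.up_left_mem hi le_rfl hmem.1
            have e1 := h2 i' j' j hj ⟨l.up_left_mem hi hj hmem.1, ht⟩ ⟨hl2, ht2⟩
            have e2 : T i j < m := by tauto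
            have e3 : T i' j ≤ T i j := by
              rcases eq_or_lt_of_le hi with rfl | hlt
              · rfl
              · exact (h3 i' i j hlt ⟨hl2, ht2⟩ ⟨hmem.1, ht3⟩).le
            right; omega }
    have hu : ∀ i j, (i, j) ∈ u ↔ (i, j) ∈ l ∧ ((i, j) ∈ t ∨ T i j < m) := by
      intro i j
      rw [← YoungDiagram.mem_cells]
      simp [u]
    refine ⟨⟨u, fun i j => if (i, j) ∈ u ∧ (i, j) ∉ t then T i j else 0⟩, ?_, ?_⟩
    · simp only [mem_sigma, mem_filter, mem_below, mem_tset]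
      have hul : u ≤ l := by rintro ⟨i, j⟩ hc; exact ((hu i j).1 hc).1
      refine ⟨⟨hul, ⟨hul, ?_⟩, ?_⟩, ?_⟩
      · intro i j hc
        rw [hu]
        have hl : (i, j) ∈ l := l.up_left_mem (by omega) le_rfl hc
        refine ⟨hl, ?_⟩
        by_cases ht : (i, j) ∈ t
        · exact Or.inl ht
        · have ht2 : (i + 1, j) ∉ t := fun hh => ht (t.up_left_mem (by omega) le_rfl hh)
          have e1 := h3 i (i + 1) j (by omega) ⟨hl, ht⟩ ⟨hc, ht2⟩
          have e2 := h1 _ _ ⟨hc, ht2⟩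
          right; omega
      · rintro ⟨i, j⟩ hc
        exact (hu i j).2 ⟨h hc, Or.inl hc⟩
      · simp only [IsSkewSSYT, mem_sdiff, YoungDiagram.mem_cells]
        refine ⟨?_, ?_, ?_, ?_⟩
        · intro i j hc
          rw [if_pos hc]
          have := (hu i j).1 hc.1
          tauto
        · intro i j1 j2 hj hc1 hc2
          rw [if_pos hc1, if_pos hc2]
          exact h2 i j1 j2 hj ⟨hul hc1.1, hc1.2⟩ ⟨hul hc2.1, hc2.2⟩
        · intro i1 i2 j hj hc1 hc2
          rw [if_pos hc1, if_pos hc2]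
          exact h3 i1 i2 j hj ⟨hul hc1.1, hc1.2⟩ ⟨hul hc2.1, hc2.2⟩
        · intro i j hc
          rw [if_neg hc]
    · funext i j
      simp only [mem_sdiff, YoungDiagram.mem_cells]
      by_cases hl : (i, j) ∈ l
      · by_cases huc : (i, j) ∈ u
        · by_cases ht : (i, j) ∈ t
          · simp only [hl, huc, ht, not_true, and_false, if_false]
            exact (h4 i j (by tauto)).symm
          · simp [hl, huc, ht]
        · simp only [hl, huc, not_false_eq_true, and_self, if_true]
          have e1 : (i, j) ∉ t := fun ht => huc ((hu i j).2 ⟨hl, Or.inl ht⟩)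
          have e2 : ¬ T i j < m := fun hh => huc ((hu i j).2 ⟨hl, Or.inr hh⟩)
          have := h1 i j ⟨hl, e1⟩
          omega
      · have huc : (i, j) ∉ u := fun hh => hl ((hu i j).1 hh).1
        simp only [hl, huc, false_and, if_false]
        exact (h4 i j (by tauto)).symm
  · rintro ⟨u, T⟩ ha
    simp only [mem_sigma, mem_filter, mem_below, mem_tset] at ha
    obtain ⟨⟨hul, hhs, htu⟩, h1, h2, h3, h4⟩ := ha
    have hul' : u.cells ⊆ l.cells := YoungDiagram.cells_subset_iff.2 hul
    have htu' : t.cells ⊆ u.cells := YoungDiagram.cells_subset_iff.2 htu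
    have hsplit : l.cells \ t.cells = (l.cells \ u.cells) ∪ (u.cells \ t.cells) := by
      ext c
      simp only [mem_sdiff, mem_union]
      have a1 := @hul' c
      have a2 := @htu' c
      tauto
    rw [hsplit, Finset.prod_union]
    · congr 1
      · rw [← card_sdiff_of_subset hul', ← Finset.prod_const]
        refine Finset.prod_congr rfl fun c hc => ?_
        exact congrArg X (if_pos hc).symm
      · refine Finset.prod_congr rfl fun c hc => ?_
        refine congrArg X (if_neg ?_).symm
        simp only [mem_sdiff] at hc ⊢
        tauto
    · rw [Finset.disjoint_left]
      intro c
      simp only [mem_sdiff]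
      tauto

/-- Add an odd letter. -/
def addY (y : R) (h : ℕ → R) : ℕ → R
  | 0 => h 0
  | k + 1 => h (k + 1) + y * h k

/-- Add an even letter. -/
def addX (x : R) (h : ℕ → R) : ℕ → R
  | 0 => h 0
  | k + 1 => h (k + 1) + x * addX x h k

lemma hz_addY (y : R) (h : ℕ → R) (z : ℤ) :
    hz (addY y h) z = hz h z + y * hz h (z - 1) := by
  rcases lt_or_ge z 0 with hz0 | hz0
  · rw [hz_neg hz0, hz_neg hz0, hz_neg (by omega)]; ring
  · obtain ⟨k, rfl⟩ := Int.eq_ofNat_of_zero_le hz0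
    cases k with
    | zero => simp [hz, addY]
    | succ k =>
      rw [show ((k + 1 : ℕ) : ℤ) - 1 = (k : ℕ) by push_cast; ring]
      simp only [hz_nat, addY]

lemma hz_addX (y : R) (h : ℕ → R) (z : ℤ) :
    hz (addX y h) z = hz h z + y * hz (addX y h) (z - 1) := by
  rcases lt_or_ge z 0 with hz0 | hz0
  · rw [hz_neg hz0, hz_neg hz0, hz_neg (by omega)]; ring
  · obtain ⟨k, rfl⟩ := Int.eq_ofNat_of_zero_le hz0
    cases k with
    | zero => simp [hz, addX]
    | succ k =>
      rw [show ((k + 1 : ℕ) : ℤ) - 1 = (k : ℕ) by push_cast; ring]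
      simp only [hz_nat, addX]

/-- Complete functions of odd letters. -/
def hY (Y : ℕ → R) : ℕ → ℕ → R
  | 0 => fun k => if k = 0 then 1 else 0
  | n + 1 => addY (Y n) (hY Y n)

/-- Supersymmetric complete functions. -/
def hXY (X Y : ℕ → R) (n : ℕ) : ℕ → ℕ → R
  | 0 => hY Y n
  | m + 1 => addX (X m) (hXY X Y n m)

lemma hY_zero (Y : ℕ → R) (n : ℕ) : hY Y n 0 = 1 := by
  induction n with
  | zero => simp [hY]
  | succ n ih => simpa [hY, addY] using ih

lemma hXY_zero (X Y : ℕ → R) (n m : ℕ) : hXY X Y n m 0 = 1 := by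
  induction m with
  | zero => simp [hXY, hY_zero]
  | succ n ih => simpa [hXY, addX] using ih

lemma sN_bot (N : ℕ) (h : ℕ → R) (h0 : h 0 = 1) : sN N h ⊥ = 1 := by
  have hb : ∀ i, (⊥ : YoungDiagram).rowLen i = 0 := fun i =>
    rowLen_eq_of_mem (by simp)
  unfold sN JT
  rw [Matrix.det_of_isUpperTriangular]
  · simp [ya, hb, hz, h0]
  · intro i j hij
    have hij' : (j : ℕ) < i := hij
    simp only [Matrix.of_apply, ya, hb]
    apply hz_neg
    push_cast
    omega

open scoped Classical in
lemma sN_unit (N : ℕ) {l : YoungDiagram} (hl : l.rowLen N = 0) :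
    sN N (fun k => if k = 0 then (1 : R) else 0) l = if l = ⊥ then 1 else 0 := by
  split_ifs with e
  · subst e
    exact sN_bot N _ (by simp)
  · have h0 : 0 < l.rowLen 0 := by
      by_contra hc
      apply e
      apply yd_ext
      intro i
      have hb : (⊥ : YoungDiagram).rowLen i = 0 := rowLen_eq_of_mem (by simp)
      rw [hb]
      exact rowLen_zero_of_le (by omega) (Nat.zero_le i)
    have hN : 0 < N := by
      by_contra hc
      have : N = 0 := by omega
      subst this
      omega
    unfold sN JT
    apply Matrix.det_eq_zero_of_row_eq_zero (⟨0, hN⟩ : Fin N)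
    intro j
    rw [Matrix.of_apply]
    have e1 : ya N l ⟨0, hN⟩ + ((j : ℕ) : ℤ) = ((l.rowLen 0 + j : ℕ) : ℤ) := by simp [ya]
    rw [e1, hz_nat, if_neg (by omega)]

lemma W_Y (Y : ℕ → R) (N n : ℕ) {l : YoungDiagram} (hl : l.rowLen N = 0) :
    W Y n l.transpose ⊥ = sN N (hY Y n) l := by
  classical
  induction n generalizing l with
  | zero =>
    rw [W_zero _ bot_le]
    simp only [hY]
    rw [sN_unit N hl]
    have : (⊥ = l.transpose) ↔ l = ⊥ := by
      constructor
      · intro h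
        rw [YoungDiagram.ext_iff, Finset.ext_iff] at *
        intro ⟨i, j⟩
        have := h (j, i)
        simp only [YoungDiagram.mem_cells, YoungDiagram.mem_transpose, Prod.swap_prod_mk] at *
        simpa using this.symm
      · rintro rfl
        ext c
        simp
    simp only [this]
  | succ n ih =>
    rw [W_succ _ _ bot_le]
    simp only [hY]
    rw [sN_vertical (hz_addY (Y n) (hY Y n)) hl]
    symm
    refine Finset.sum_bij (fun u _ => u.transpose) ?_ ?_ ?_ ?_
    · intro u hu
      simp only [mem_filter, mem_below] at hu ⊢
      exact ⟨YoungDiagram.transpose_le_iff.2 hu.1, HS_transpose.2 hu.2, bot_le⟩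
    · intro u _ u' _ he
      exact YoungDiagram.transpose_eq_iff.1 he
    · intro u hu
      simp only [mem_filter, mem_below] at hu
      refine ⟨u.transpose, ?_, YoungDiagram.transpose_transpose u⟩
      simp only [mem_filter, mem_below]
      rw [← HS_transpose, YoungDiagram.transpose_transpose]
      refine ⟨?_, hu.2.1⟩
      rw [← YoungDiagram.transpose_le_iff, YoungDiagram.transpose_transpose]
      exact hu.1
    · intro u hu
      simp only [mem_filter, mem_below] at hu
      have hN : u.rowLen N = 0 := by have := yd_le_iff.1 hu.1 N; omega
      rw [ih hN]
      have hc : ∀ v : YoungDiagram, v.transpose.cells.card = v.cells.card := by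
        intro v
        simp [YoungDiagram.transpose]
      rw [hc, hc]

lemma W_XY (X Y : ℕ → R) (N n m : ℕ) {l : YoungDiagram} (hl : l.rowLen N = 0) :
    ∑ t ∈ below l, W X m l t * W Y n t.transpose ⊥ = sN N (hXY X Y n m) l := by
  classical
  induction m generalizing l with
  | zero =>
    rw [Finset.sum_eq_single l]
    · rw [W_zero _ le_rfl, if_pos rfl, one_mul, W_Y Y N n hl]; rfl
    · intro t ht hne
      rw [W_zero _ (mem_below.1 ht), if_neg hne, zero_mul]
    · intro h; exact absurd (mem_below.2 le_rfl) h
  | succ m ih =>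
    simp only [hXY]
    rw [sN_horizontal (hz_addX (X m) (hXY X Y n m)) hl]
    have e : ∀ u ∈ (below l).filter (fun u => HS l u),
        X m ^ (l.cells.card - u.cells.card) * sN N (hXY X Y n m) u =
        ∑ t ∈ below u, X m ^ (l.cells.card - u.cells.card) *
          (W X m u t * W Y n t.transpose ⊥) := by
      intro u hu
      simp only [mem_filter, mem_below] at hu
      have hN : u.rowLen N = 0 := by have := yd_le_iff.1 hu.1 N; omega
      rw [← ih hN, Finset.mul_sum]
    rw [Finset.sum_congr rfl e]
    have e2 : ∀ t ∈ below l, W X (m + 1) l t * W Y n t.transpose ⊥ =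
        ∑ u ∈ (below l).filter (fun u => HS l u ∧ t ≤ u),
          X m ^ (l.cells.card - u.cells.card) * (W X m u t * W Y n t.transpose ⊥) := by
      intro t ht
      rw [W_succ _ _ (mem_below.1 ht), Finset.sum_mul]
      refine Finset.sum_congr rfl fun u _ => by ring
    rw [Finset.sum_congr rfl e2]
    apply Finset.sum_comm'
    intro t u
    simp only [mem_filter, mem_below]
    constructor
    · rintro ⟨h1, h2, h3, h4⟩; exact ⟨h4, h2, h3⟩
    · rintro ⟨h1, h2, h3⟩; exact ⟨h1.trans h2, h2, h3, h1⟩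

end HWF

namespace HWF
open Finset

/-- Even variables. -/
def Xv (m n : ℕ) (k : ℕ) : MvPowerSeries (Fin m ⊕ Fin n) ℚ :=
  if h : k < m then MvPowerSeries.X (Sum.inl ⟨k, h⟩) else 0

/-- Odd variables. -/
def Yv (m n : ℕ) (k : ℕ) : MvPowerSeries (Fin m ⊕ Fin n) ℚ :=
  if h : k < n then MvPowerSeries.X (Sum.inr ⟨k, h⟩) else 0

lemma prod_monomial_one {σ ι : Type*} (s : Finset ι) (w : ι → (σ →₀ ℕ)) :
    ∏ c ∈ s, (MvPowerSeries.monomial (w c) (1 : ℚ)) =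
      MvPowerSeries.monomial (∑ c ∈ s, w c) (1 : ℚ) := by
  classical
  induction s using Finset.induction_on with
  | empty => simp
  | insert a s ha ih =>
    rw [Finset.prod_insert ha, ih, Finset.sum_insert ha, MvPowerSeries.monomial_mul_monomial,
      one_mul]

open scoped Classical in
lemma prod_X (m n : ℕ) (s : Finset (ℕ × ℕ)) (T : ℕ → ℕ → ℕ) (hT : ∀ c ∈ s, T c.1 c.2 < m) :
    ∃ e : (Fin m ⊕ Fin n) →₀ ℕ, ∏ c ∈ s, Xv m n (T c.1 c.2) = MvPowerSeries.monomial e 1 ∧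
      (∀ k : Fin m, e (Sum.inl k) = (s.filter fun c => T c.1 c.2 = k.val).card) ∧
      ∀ k : Fin n, e (Sum.inr k) = 0 := by
  let w : ℕ × ℕ → ((Fin m ⊕ Fin n) →₀ ℕ) := fun c =>
    if h : T c.1 c.2 < m then Finsupp.single (Sum.inl ⟨T c.1 c.2, h⟩) 1 else 0
  refine ⟨∑ c ∈ s, w c, ?_, ?_, ?_⟩
  · rw [← prod_monomial_one]
    refine Finset.prod_congr rfl fun c hc => ?_
    simp only [Xv, w, dif_pos (hT c hc)]
    rfl
  · intro k
    rw [Finsupp.finset_sum_apply, Finset.card_filter]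
    refine Finset.sum_congr rfl fun c hc => ?_
    simp only [w, dif_pos (hT c hc), Finsupp.single_apply, Sum.inl.injEq, Fin.ext_iff]
  · intro k
    rw [Finsupp.finset_sum_apply]
    refine Finset.sum_eq_zero fun c hc => ?_
    simp [w, dif_pos (hT c hc), Finsupp.single_apply]

open scoped Classical in
lemma prod_Y (m n : ℕ) (s : Finset (ℕ × ℕ)) (T : ℕ → ℕ → ℕ) (hT : ∀ c ∈ s, T c.1 c.2 < n) :
    ∃ e : (Fin m ⊕ Fin n) →₀ ℕ, ∏ c ∈ s, Yv m n (T c.1 c.2) = MvPowerSeries.monomial e 1 ∧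
      (∀ k : Fin n, e (Sum.inr k) = (s.filter fun c => T c.1 c.2 = k.val).card) ∧
      ∀ k : Fin m, e (Sum.inl k) = 0 := by
  let w : ℕ × ℕ → ((Fin m ⊕ Fin n) →₀ ℕ) := fun c =>
    if h : T c.1 c.2 < n then Finsupp.single (Sum.inr ⟨T c.1 c.2, h⟩) 1 else 0
  refine ⟨∑ c ∈ s, w c, ?_, ?_, ?_⟩
  · rw [← prod_monomial_one]
    refine Finset.prod_congr rfl fun c hc => ?_
    simp only [Yv, w, dif_pos (hT c hc)]
    rfl
  · intro k
    rw [Finsupp.finset_sum_apply, Finset.card_filter]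
    refine Finset.sum_congr rfl fun c hc => ?_
    simp only [w, dif_pos (hT c hc), Finsupp.single_apply, Sum.inr.injEq, Fin.ext_iff]
  · intro k
    rw [Finsupp.finset_sum_apply]
    refine Finset.sum_eq_zero fun c hc => ?_
    simp [w, dif_pos (hT c hc), Finsupp.single_apply]

lemma coeff_super (m n N : ℕ) {l : YoungDiagram} (hl : l.rowLen N = 0)
    (d : (Fin m ⊕ Fin n) →₀ ℕ) :
    (superSchurCoeff m n l d : ℚ) =
      MvPowerSeries.coeff d (sN N (hXY (Xv m n) (Yv m n) n m) l) := by
  classical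
  rw [← W_XY]
  swap
  · exact hl
  let F : Finset (Σ _ : YoungDiagram, (ℕ → ℕ → ℕ) × (ℕ → ℕ → ℕ)) :=
    (below l).sigma fun t => tset m l t ×ˢ tset n t.transpose ⊥
  let P : YoungDiagram → (ℕ → ℕ → ℕ) → (ℕ → ℕ → ℕ) → Prop := fun t T U =>
    (∀ k : Fin m, d (Sum.inl k)
        = ((l.cells \ t.cells).filter fun c => T c.1 c.2 = k.val).card) ∧
    (∀ k : Fin n, d (Sum.inr k)
        = ((t.transpose.cells \ (⊥ : YoungDiagram).cells).filter
            fun c => U c.1 c.2 = k.val).card)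
  have h1 : superSchurCoeff m n l d =
      ((F.filter fun a => P a.1 a.2.1 a.2.2).map
        (Equiv.sigmaEquivProd YoungDiagram ((ℕ → ℕ → ℕ) × (ℕ → ℕ → ℕ))).toEmbedding).card := by
    unfold superSchurCoeff
    rw [← Set.ncard_coe_finset]
    congr 1
    ext ⟨t, T, U⟩
    simp only [Set.mem_ofPred_eq, coe_map, Set.mem_image, mem_coe, mem_filter, F, mem_sigma,
      mem_product, mem_tset, mem_below, P]
    constructor
    · rintro ⟨a, b, c, e, f⟩
      exact ⟨⟨t, T, U⟩, ⟨⟨a, b, c⟩, e, f⟩, rfl⟩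
    · rintro ⟨⟨t', T', U'⟩, ⟨⟨a, b, c⟩, e, f⟩, he⟩
      simp only [Equiv.sigmaEquivProd, Equiv.coe_toEmbedding, Equiv.coe_fn_mk, Prod.mk.injEq] at he
      obtain ⟨rfl, rfl, rfl⟩ := he
      exact ⟨a, b, c, e, f⟩
  rw [h1, card_map, Finset.card_filter, Finset.sum_sigma, map_sum]
  push_cast
  refine Finset.sum_congr rfl fun t _ => ?_
  unfold W
  rw [Finset.sum_mul_sum, ← Finset.sum_product', map_sum]
  refine Finset.sum_congr rfl fun ⟨T, U⟩ hTU => ?_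
  simp only [mem_product, mem_tset] at hTU
  obtain ⟨e, he1, he2, he3⟩ := prod_X m n (l.cells \ t.cells) T
    (fun c hc => hTU.1.1 c.1 c.2 hc)
  obtain ⟨f, hf1, hf2, hf3⟩ := prod_Y m n (t.transpose.cells \ (⊥ : YoungDiagram).cells) U
    (fun c hc => hTU.2.1 c.1 c.2 hc)
  rw [he1, hf1, MvPowerSeries.monomial_mul_monomial, MvPowerSeries.coeff_monomial, one_mul]
  have : P t T U ↔ d = e + f := by
    simp only [P]
    constructor
    · rintro ⟨p1, p2⟩
      ext (k | k)
      · rw [p1 k, Finsupp.add_apply, he2, hf3, add_zero]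
      · rw [p2 k, Finsupp.add_apply, hf2, he3, zero_add]
    · rintro rfl
      constructor
      · intro k
        rw [Finsupp.add_apply, he2, hf3, add_zero]
      · intro k
        rw [Finsupp.add_apply, hf2, he3, zero_add]
  simp only [this]

/-- Homogeneity of the coefficients. -/
lemma superSchurCoeff_degree (m n : ℕ) {l : YoungDiagram} {d : (Fin m ⊕ Fin n) →₀ ℕ}
    (h : superSchurCoeff m n l d ≠ 0) : l.cells.card = ∑ k, d k := by
  classical
  obtain ⟨⟨t, T, U⟩, h1, h2, h3, h4, h5⟩ := Set.nonempty_of_ncard_ne_zero h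
  simp only at h1 h2 h3 h4 h5
  have e1 : ∀ (s : Finset (ℕ × ℕ)) (T : ℕ → ℕ → ℕ) (m : ℕ), (∀ c ∈ s, T c.1 c.2 < m) →
      ∑ k : Fin m, (s.filter fun c => T c.1 c.2 = k.val).card = s.card := by
    intro s T m hT
    rw [Finset.card_eq_sum_card_fiberwise (f := fun c => T c.1 c.2) (t := range m)]
    · rw [← Fin.sum_univ_eq_sum_range (fun k => (s.filter fun c => T c.1 c.2 = k).card)]
    · intro c hc
      simpa using hT c hc
  rw [Fintype.sum_sum_type]
  simp only [h4, h5]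
  rw [e1 _ _ _ (fun c hc => h2.1 c.1 c.2 hc), e1 _ _ _ (fun c hc => h3.1 c.1 c.2 hc)]
  have hc : t.transpose.cells.card = t.cells.card := by
    simp [YoungDiagram.transpose]
  have hs : t.cells ⊆ l.cells := YoungDiagram.cells_subset_iff.2 h1
  rw [card_sdiff_of_subset hs, YoungDiagram.cells_bot, sdiff_empty, hc]
  have := card_le_card hs
  omega

/-- Vanishing outside of the hook. -/
lemma superSchurCoeff_hook (m n : ℕ) {l : YoungDiagram} {d : (Fin m ⊕ Fin n) →₀ ℕ}
    (h : superSchurCoeff m n l d ≠ 0) : l.rowLen m ≤ n := by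
  obtain ⟨⟨t, T, U⟩, h1, h2, h3, h4, h5⟩ := Set.nonempty_of_ncard_ne_zero h
  simp only at h1 h2 h3 h4 h5
  by_contra hc
  have hmn : (m, n) ∈ l := YoungDiagram.mem_iff_lt_rowLen.2 (by omega)
  -- strictly increasing columns
  have key : ∀ (N : ℕ) (a b : YoungDiagram) (V : ℕ → ℕ → ℕ), IsSkewSSYT N a b V → ∀ j,
      (∀ i ≤ N, (i, j) ∈ a.cells \ b.cells) → False := by
    intro N a b V hV j hj
    have hi : ∀ i ≤ N, i ≤ V i j := by
      intro i
      induction i with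
      | zero => intro; omega
      | succ i ih =>
        intro hi
        have e1 := ih (by omega)
        have e2 := hV.2.2.1 i (i + 1) j (by omega) (hj i (by omega)) (hj (i + 1) hi)
        omega
    have e1 := hi N le_rfl
    have e2 := hV.1 N j (hj N le_rfl)
    omega
  by_cases ht : (0, n) ∈ t
  · refine key n t.transpose ⊥ U h3 0 fun i hi => ?_
    simp only [YoungDiagram.cells_bot, sdiff_empty, YoungDiagram.mem_cells,
      YoungDiagram.mem_transpose, Prod.swap_prod_mk]
    exact t.up_left_mem le_rfl hi ht
  · refine key m l t T h2 n fun i hi => ?_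
    simp only [mem_sdiff, YoungDiagram.mem_cells]
    exact ⟨l.up_left_mem hi le_rfl hmn, fun hh => ht (t.up_left_mem (Nat.zero_le i) le_rfl hh)⟩

end HWF

namespace HWF
open Finset

/-- Partial fraction identity. -/
lemma pfrac {K : Type*} [Field K] [DecidableEq K] (s : Finset K) (h1 : (-1 : K) ∉ s) :
    ∑ a ∈ s, (1 - a) * ∏ b ∈ s.erase a, ((1 - b * a) / (b - a)) = 1 - ∏ b ∈ s, b := by
  let P : Polynomial K := ∏ b ∈ s, (1 - Polynomial.C b * Polynomial.X)
  have hdeg : ∀ b : K, (1 - Polynomial.C b * Polynomial.X : Polynomial K).natDegree ≤ 1 := by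
    intro b
    compute_degree
  have hP : P.degree < ((insert (-1) s : Finset K).card) := by
    refine lt_of_le_of_lt Polynomial.degree_le_natDegree ?_
    rw [card_insert_of_notMem h1]
    have : P.natDegree ≤ s.card := by
      refine (Polynomial.natDegree_prod_le _ _).trans ?_
      refine (Finset.sum_le_sum fun b _ => hdeg b).trans ?_
      simp
    exact_mod_cast Nat.lt_succ_of_le this
  have hc : P.coeff s.card = (-1) ^ s.card * ∏ b ∈ s, b := by
    have := Polynomial.coeff_prod_of_natDegree_le s
      (fun b => (1 - Polynomial.C b * Polynomial.X : Polynomial K)) 1 (fun b _ => hdeg b)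
    rw [mul_one] at this
    rw [show P.coeff s.card = _ from this]
    rw [← Finset.prod_const, ← Finset.prod_mul_distrib]
    refine Finset.prod_congr rfl fun b _ => ?_
    simp [Polynomial.coeff_one]
  have key := Lagrange.coeff_eq_sum (s := insert (-1) s) (v := (id : K → K))
    (Set.injOn_id _) (P := P) (by simpa using hP)
  rw [card_insert_of_notMem h1, Nat.add_sub_cancel, hc, sum_insert h1] at key
  have e0 : ∀ t : K, P.eval t = ∏ b ∈ s, (1 - b * t) := by
    intro t; simp [P, Polynomial.eval_prod]
  have e1 : P.eval (id (-1)) / ∏ j ∈ (insert (-1) s).erase (-1), (id (-1 : K) - id j) =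
      (-1) ^ s.card := by
    rw [erase_insert h1, e0, ← Finset.prod_div_distrib, ← Finset.prod_const]
    refine Finset.prod_congr rfl fun b hb => ?_
    have : (-1 : K) - b ≠ 0 := by
      intro h; apply h1; rw [sub_eq_zero.mp h]; exact hb
    simp only [id]
    rw [div_eq_iff this]; ring
  have e2 : ∀ a ∈ s, P.eval (id a) / ∏ j ∈ (insert (-1) s).erase a, (id (a : K) - id j) =
      - (-1) ^ s.card * ((1 - a) * ∏ b ∈ s.erase a, ((1 - b * a) / (b - a))) := by
    intro a ha
    have hne : a ≠ -1 := fun h => h1 (h ▸ ha)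
    have h3 : 1 + a ≠ 0 := by
      intro h; apply hne; linear_combination h
    rw [erase_insert_of_ne hne.symm, prod_insert (by simp [h1]), e0, ← mul_prod_erase s _ ha]
    have h4 : ∏ j ∈ s.erase a, (id a - id j) = - (-1) ^ s.card * ∏ b ∈ s.erase a, (b - a) := by
      rw [show s.card = (s.erase a).card + 1 from (card_erase_add_one ha).symm, pow_succ,
        ← Finset.prod_const]
      rw [show -((∏ x ∈ s.erase a, (-1 : K)) * -1) = ∏ x ∈ s.erase a, (-1 : K) by ring,
        ← Finset.prod_mul_distrib]
      refine Finset.prod_congr rfl fun b _ => ?_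
      simp
    have h5 : ∏ b ∈ s.erase a, (b - a) ≠ 0 := by
      rw [Finset.prod_ne_zero_iff]
      intro b hb
      exact sub_ne_zero.mpr (mem_erase.mp hb).1
    have h6 : ((-1 : K) ^ s.card) * (-1) ^ s.card = 1 := by
      rw [← mul_pow]; simp
    rw [h4, Finset.prod_div_distrib]
    have h7 : ((-1 : K) ^ s.card) ≠ 0 := pow_ne_zero _ (by simp)
    simp only [id]
    have h8 : a - -1 ≠ 0 := by rw [sub_neg_eq_add, add_comm]; exact h3
    generalize ∏ x ∈ s.erase a, (1 - x * a) = A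
    generalize ∏ b ∈ s.erase a, (b - a) = B at h5 ⊢
    generalize (-1 : K) ^ s.card = C at h6 h7 ⊢
    field_simp
    linear_combination (1 - a) * (1 + a) * A * h6
  rw [e1, Finset.sum_congr rfl e2, ← Finset.mul_sum] at key
  have h7 : ((-1 : K) ^ s.card) ≠ 0 := pow_ne_zero _ (by simp)
  apply mul_left_cancel₀ h7
  linear_combination key

/-- Removing a row of a projective Vandermonde determinant. -/
lemma projV_remove {R : Type*} [CommRing R] {m : ℕ} (v w : Fin (m + 1) → R) (k : Fin (m + 1)) :
    (Matrix.projVandermonde v w).det = (-1) ^ (k : ℕ) *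
      (∏ j : Fin m, (v (k.succAbove j) * w k - v k * w (k.succAbove j))) *
      (Matrix.projVandermonde (fun j => v (k.succAbove j)) (fun j => w (k.succAbove j))).det := by
  have h1 := Matrix.det_permute (k.cycleRange.symm) (Matrix.projVandermonde v w)
  have h2 : (Matrix.projVandermonde v w).submatrix (k.cycleRange.symm) id =
    Matrix.projVandermonde (fun j => v (k.cycleRange.symm j)) (fun j => w (k.cycleRange.symm j)) := by
    ext i j; simp [Matrix.projVandermonde_apply]
  rw [h2] at h1
  have h3 : (Equiv.Perm.sign (k.cycleRange.symm) : ℤ) = (-1) ^ (k : ℕ) := by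
    rw [Equiv.Perm.sign_symm, Fin.sign_cycleRange]; simp
  have h4 : (Matrix.projVandermonde (fun j => v (k.cycleRange.symm j))
      (fun j => w (k.cycleRange.symm j))).det =
      (∏ j : Fin m, (v (k.succAbove j) * w k - v k * w (k.succAbove j))) *
      (Matrix.projVandermonde (fun j => v (k.succAbove j)) (fun j => w (k.succAbove j))).det := by
    rw [Matrix.det_projVandermonde, Matrix.det_projVandermonde, Fin.prod_univ_succ,
      Fin.prod_Ioi_zero]
    simp only [Fin.prod_Ioi_succ, Fin.cycleRange_symm_zero, Fin.cycleRange_symm_succ]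
  rw [mul_assoc, ← h4, h1]
  rw [h3]
  push_cast
  rw [← mul_assoc, ← mul_pow]; simp

end HWF

namespace HWF
open Finset

/-- The numerator determinant. -/
def GG {K : Type*} [CommRing K] {m : ℕ} (x z : Fin m → K) : K :=
  Matrix.det (Matrix.of fun j i : Fin m => x j ^ (i.rev : ℕ) - z j * x j ^ (i : ℕ))

/-- The projective Vandermonde determinant attached to a Boolean vector. -/
def VB {K : Type*} [CommRing K] {m : ℕ} (x : Fin m → K) (b : Fin m → Bool) : K :=
  (Matrix.projVandermonde (fun j => if b j then x j else 1) (fun j => if b j then 1 else x j)).det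

lemma GG_expand {K : Type*} [CommRing K] {m : ℕ} (x z : Fin m → K) :
    GG x z = ∑ b : Fin m → Bool, (∏ j, if b j then -z j else 1) * VB x b := by
  have h1 : (Matrix.of fun j i : Fin m => x j ^ (i.rev : ℕ) - z j * x j ^ (i : ℕ)) =
      fun j => ∑ c : Bool, (fun i : Fin m => if c then - z j * x j ^ (i : ℕ) else x j ^ (i.rev : ℕ)) := by
    ext j i
    simp only [Matrix.of_apply, Finset.sum_apply, Fintype.sum_bool]
    simp; ring
  unfold GG
  rw [h1]
  change (Matrix.detRowAlternating (R := K) (n := Fin m)).toMultilinearMap _ = _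
  rw [MultilinearMap.map_sum]
  refine Finset.sum_congr rfl fun b _ => ?_
  unfold VB
  rw [← Matrix.det_mul_column]
  change Matrix.det _ = _
  congr 1
  ext j i
  simp only [Matrix.of_apply, Matrix.projVandermonde_apply]
  by_cases h : b j <;> simp [h]

lemma prod_succAbove {K : Type*} [CommMonoid K] {m : ℕ} (k : Fin (m + 1)) (g : Fin (m + 1) → K) :
    ∏ j : Fin m, g (k.succAbove j) = ∏ j ∈ univ.erase k, g j := by
  rw [show univ.erase k = univ.image k.succAbove by
    ext j; simp [Fin.exists_succAbove_eq_iff], Finset.prod_image]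
  intro a _ b _ h
  exact Fin.succAbove_right_injective h

lemma GG_rec_b {K : Type*} [Field K] {m : ℕ} (x z : Fin (m + 1) → K)
    (hx : Function.Injective x) (h1 : ∀ j, x j ≠ -1) (b : Fin (m + 1) → Bool) :
    (∏ j, if b j then -(x j * z j) else 1) * VB x b - (∏ j, if b j then -z j else 1) * VB x b =
    ∑ k, if b k then (-1) ^ (k : ℕ) * z k * (1 - x k) *
      (∏ j : Fin m, (1 - x (k.succAbove j) * x k)) *
      ((∏ j : Fin m, if b (k.succAbove j) then -z (k.succAbove j) else 1) *
        VB (fun j => x (k.succAbove j)) (fun j => b (k.succAbove j))) else 0 := by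
  classical
  set c := ∏ j, if b j then -z j else 1 with hc
  have e1 : (∏ j, if b j then -(x j * z j) else 1) = (∏ j with b j, x j) * c := by
    rw [hc, Finset.prod_filter, ← Finset.prod_mul_distrib]
    refine Finset.prod_congr rfl fun j _ => ?_
    split_ifs <;> ring
  have pf := pfrac ((univ.filter fun j => b j).image x) (by
    intro h
    obtain ⟨j, _, hj⟩ := Finset.mem_image.mp h
    exact h1 j hj)
  rw [Finset.prod_image hx.injOn, Finset.sum_image hx.injOn] at pf
  have e2 : ∀ k, (if b k then (-1) ^ (k : ℕ) * z k * (1 - x k) *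
      (∏ j : Fin m, (1 - x (k.succAbove j) * x k)) *
      ((∏ j : Fin m, if b (k.succAbove j) then -z (k.succAbove j) else 1) *
        VB (fun j => x (k.succAbove j)) (fun j => b (k.succAbove j))) else 0) =
      if b k then - c * VB x b * ((1 - x k) * ∏ t ∈ ((univ.filter fun j => b j).image x).erase (x k),
        ((1 - t * x k) / (t - x k))) else 0 := by
    intro k
    by_cases hk : b k
    swap
    · simp [hk]
    rw [if_pos hk, if_pos hk]
    have f1 : c = -z k * ∏ j : Fin m, if b (k.succAbove j) then -z (k.succAbove j) else 1 := by
      rw [hc, Fin.prod_univ_succAbove _ k]; simp [hk]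
    have f2 : ∏ t ∈ ((univ.filter fun j => b j).image x).erase (x k), ((1 - t * x k) / (t - x k)) =
        ∏ j : Fin m, if b (k.succAbove j) then (1 - x (k.succAbove j) * x k) /
          (x (k.succAbove j) - x k) else 1 := by
      rw [← Finset.image_erase hx, Finset.prod_image hx.injOn,
        prod_succAbove k (fun j => if b j then (1 - x j * x k) / (x j - x k) else 1),
        ← Finset.prod_filter]
      congr 1
      ext j; simp [and_comm]
    have f3 : VB x b = (-1) ^ (k : ℕ) * (∏ j : Fin m, if b (k.succAbove j) then
        x (k.succAbove j) - x k else 1 - x (k.succAbove j) * x k) *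
        VB (fun j => x (k.succAbove j)) (fun j => b (k.succAbove j)) := by
      unfold VB
      rw [projV_remove _ _ k]
      congr 2
      refine Finset.prod_congr rfl fun j _ => ?_
      by_cases hj : b (k.succAbove j) <;> simp [hj, hk]
      ring
    have f4 : (∏ j : Fin m, if b (k.succAbove j) then
        x (k.succAbove j) - x k else 1 - x (k.succAbove j) * x k) *
        (∏ j : Fin m, if b (k.succAbove j) then (1 - x (k.succAbove j) * x k) /
          (x (k.succAbove j) - x k) else 1) = ∏ j : Fin m, (1 - x (k.succAbove j) * x k) := by
      rw [← Finset.prod_mul_distrib]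
      refine Finset.prod_congr rfl fun j _ => ?_
      have : x (k.succAbove j) - x k ≠ 0 :=
        sub_ne_zero.mpr fun h => Fin.succAbove_ne k j (hx h)
      split_ifs
      · field_simp
      · ring
    rw [f2, f3, f1, ← f4]
    ring
  rw [Finset.sum_congr rfl fun k _ => e2 k, ← Finset.sum_filter, ← Finset.mul_sum, pf, e1]
  ring

lemma GG_rec {K : Type*} [Field K] {m : ℕ} (x z : Fin (m + 1) → K)
    (hx : Function.Injective x) (h1 : ∀ j, x j ≠ -1) :
    GG x (fun j => x j * z j) - GG x z = ∑ k : Fin (m + 1), (-1) ^ (k : ℕ) * z k * (1 - x k) *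
      (∏ j : Fin m, (1 - x (k.succAbove j) * x k)) *
      GG (fun j => x (k.succAbove j)) (fun j => z (k.succAbove j)) := by
  rw [GG_expand, GG_expand, ← Finset.sum_sub_distrib,
    Finset.sum_congr rfl fun b _ => GG_rec_b x z hx h1 b, Finset.sum_comm]
  refine Finset.sum_congr rfl fun k _ => ?_
  rw [GG_expand, Finset.mul_sum]
  rw [← Equiv.sum_comp (Fin.insertNthEquiv (fun _ => Bool) k), Fintype.sum_prod_type]
  rw [Fintype.sum_bool]
  simp [Fin.insertNthEquiv]

lemma GG_one {K : Type*} [Field K] {m : ℕ} (x : Fin (m + 1) → K) :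
    GG x (fun _ => 1) = 0 := by
  unfold GG
  rw [← Matrix.exists_mulVec_eq_zero_iff]
  refine ⟨fun _ => 1, fun h => one_ne_zero (congrFun h 0), ?_⟩
  ext j
  simp only [Matrix.mulVec, dotProduct, Matrix.of_apply, mul_one, one_mul, Pi.zero_apply,
    Finset.sum_sub_distrib]
  rw [sub_eq_zero]
  exact Equiv.sum_comp Fin.revPerm (fun i : Fin (m + 1) => x j ^ (i : ℕ))

/-- The denominator. -/
def DD {K : Type*} [CommRing K] {m : ℕ} (x : Fin m → K) : K :=
  (∏ i, (1 - x i)) * ∏ i, ∏ j, if i < j then 1 - x i * x j else 1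

lemma DD_remove {K : Type*} [CommRing K] {m : ℕ} (x : Fin (m + 1) → K) (k : Fin (m + 1)) :
    DD x = (1 - x k) * (∏ j : Fin m, (1 - x (k.succAbove j) * x k)) *
      DD (fun j => x (k.succAbove j)) := by
  unfold DD
  rw [Fin.prod_univ_succAbove _ k, Fin.prod_univ_succAbove _ k]
  simp_rw [Fin.prod_univ_succAbove (fun j => if _ < j then _ else (1 : K)) k]
  simp only [lt_irrefl, if_false, one_mul, Finset.prod_mul_distrib,
    (Fin.strictMono_succAbove k).lt_iff_lt]
  have : (∏ j : Fin m, (1 - x (k.succAbove j) * x k)) =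
    (∏ i : Fin m, if k < k.succAbove i then 1 - x k * x (k.succAbove i) else 1) *
    ∏ i : Fin m, if k.succAbove i < k then 1 - x (k.succAbove i) * x k else 1 := by
    rw [← Finset.prod_mul_distrib]
    refine Finset.prod_congr rfl fun j _ => ?_
    rcases lt_or_gt_of_ne (Fin.succAbove_ne k j) with h | h
    · rw [if_pos h, if_neg (not_lt_of_gt h), one_mul]
    · rw [if_neg (not_lt_of_gt h), if_pos h, mul_one, mul_comm (x k)]
  rw [this]
  ring

/-- Strictly decreasing exponent vectors with entries below `M`. -/
def SA (m M : ℕ) : Finset (Fin m → ℕ) :=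
  (Fintype.piFinset fun _ => range M).filter StrictAnti

lemma mem_SA {m M : ℕ} {e : Fin m → ℕ} : e ∈ SA m M ↔ (∀ i, e i < M) ∧ StrictAnti e := by
  simp [SA]

/-- The alternant. -/
def alt {K : Type*} [CommRing K] {m : ℕ} (x : Fin m → K) (e : Fin m → ℕ) : K :=
  Matrix.det (Matrix.of fun i j : Fin m => x j ^ e i)

/-- Sum of all alternants with exponents below `M`. -/
def FF {K : Type*} [CommRing K] {m : ℕ} (M : ℕ) (x : Fin m → K) : K :=
  ∑ e ∈ SA m M, alt x e

lemma alt_cons {K : Type*} [CommRing K] {m : ℕ} (x : Fin (m + 1) → K) (M : ℕ) (e : Fin m → ℕ) :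
    alt x (Fin.cons M e) = ∑ k : Fin (m + 1), (-1) ^ (k : ℕ) * x k ^ M *
      alt (fun j => x (k.succAbove j)) e := by
  unfold alt
  rw [Matrix.det_succ_row_zero]
  rfl

lemma FF_rec {K : Type*} [CommRing K] {m M : ℕ} (x : Fin (m + 1) → K) :
    FF (M + 1) x = FF M x + ∑ k : Fin (m + 1), (-1) ^ (k : ℕ) * x k ^ M *
      FF M (fun j => x (k.succAbove j)) := by
  classical
  have h : SA (m + 1) (M + 1) = SA (m + 1) M ∪ (SA m M).image (fun e' => (Fin.cons M e' : Fin (m + 1) → ℕ)) := by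
    ext e
    simp only [mem_union, mem_image, mem_SA]
    constructor
    · rintro ⟨h1, h2⟩
      by_cases h0 : e 0 = M
      · right
        refine ⟨Fin.tail e, ⟨fun i => ?_, fun i j hij => h2 (by simpa using hij)⟩, ?_⟩
        · rw [← h0]; exact h2 (Fin.succ_pos i)
        · rw [← h0]; exact Fin.cons_self_tail e
      · left
        refine ⟨fun i => ?_, h2⟩
        have := h2.antitone (Fin.zero_le i)
        have := h1 0
        omega
    · rintro (⟨h1, h2⟩ | ⟨e', ⟨h1, h2⟩, rfl⟩)
      · exact ⟨fun i => (h1 i).trans (Nat.lt_succ_self M), h2⟩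
      · refine ⟨fun i => ?_, ?_⟩
        · refine Fin.cases ?_ (fun i => ?_) i
          · simp
          · simpa using (h1 i).trans (Nat.lt_succ_self M)
        · intro i j hij
          induction j using Fin.cases with
          | zero => exact absurd hij (Fin.not_lt_zero i)
          | succ j =>
            induction i using Fin.cases with
            | zero => simpa using h1 j
            | succ i => simpa using h2 (by simpa using hij)
  have hd : Disjoint (SA (m + 1) M) ((SA m M).image (fun e' => (Fin.cons M e' : Fin (m + 1) → ℕ))) := by
    rw [Finset.disjoint_left]
    intro e he h'
    obtain ⟨e', _, rfl⟩ := mem_image.mp h'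
    have := (mem_SA.mp he).1 0
    simp at this
  unfold FF
  rw [h, sum_union hd, sum_image (by
    intro a _ b _ hab
    exact (Fin.cons_injective2 hab).2)]
  simp_rw [alt_cons, Finset.mul_sum]
  rw [Finset.sum_comm]

lemma FF_DD {K : Type*} [Field K] (M : ℕ) : ∀ {m : ℕ} (x : Fin m → K)
    (_ : Function.Injective x) (_ : ∀ j, x j ≠ -1),
    FF M x * DD x = GG x (fun j => x j ^ M) := by
  induction M with
  | zero =>
    intro m x hx h1
    cases m with
    | zero =>
      have : SA 0 0 = {Fin.elim0} := by
        ext e; simp [mem_SA]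
        exact ⟨fun _ => Subsingleton.elim _ _, fun _ i => i.elim0⟩
      simp [FF, DD, GG, this, alt]
    | succ m =>
      have : SA (m + 1) 0 = ∅ := by
        ext e; simp [mem_SA]
      simp [FF, this, GG_one]
  | succ M ih =>
    intro m x hx h1
    cases m with
    | zero =>
      have : SA 0 (M + 1) = {Fin.elim0} := by
        ext e; simp [mem_SA]
        exact ⟨fun _ => Subsingleton.elim _ _, fun _ i => i.elim0⟩
      simp [FF, DD, GG, this, alt]
    | succ m =>
      rw [FF_rec, add_mul, ih x hx h1]
      have h := GG_rec x (fun j => x j ^ M) hx h1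
      simp_rw [← pow_succ'] at h
      rw [eq_comm, ← sub_eq_iff_eq_add', h, Finset.sum_mul]
      refine Finset.sum_congr rfl fun k _ => ?_
      rw [← ih (fun j => x (k.succAbove j)) (hx.comp Fin.succAbove_right_injective)
        (fun j => h1 _), DD_remove x k]
      ring

end HWF

namespace HWF
open Finset

/-- Complete homogeneous symmetric functions. -/
def hx {R : Type*} [CommRing R] {N : ℕ} (x : Fin N → R) (k : ℕ) : R :=
  PowerSeries.coeff k (∏ j, PowerSeries.mk fun k => x j ^ k)

/-- Beta numbers. -/
def ee (N : ℕ) (l : YoungDiagram) (i : Fin N) : ℕ := l.rowLen i + (i.rev : ℕ)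

lemma mk_pow_mul {R : Type*} [CommRing R] (a : R) :
    (PowerSeries.mk fun k => a ^ k) * (1 - PowerSeries.C a * PowerSeries.X) = 1 := by
  have h := PowerSeries.mk_one_mul_one_sub_eq_one R
  have h2 := congrArg (PowerSeries.rescale a) h
  simp only [map_mul, map_sub, map_one, PowerSeries.rescale_X, PowerSeries.rescale_mk] at h2
  simpa using h2

lemma hx_zero {R : Type*} [CommRing R] {N : ℕ} (x : Fin N → R) : hx x 0 = 1 := by
  unfold hx
  rw [PowerSeries.coeff_zero_eq_constantCoeff_apply, map_prod]
  simp [← PowerSeries.coeff_zero_eq_constantCoeff_apply]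

/-- Truncated elementary polynomial. -/
def Ej {R : Type*} [CommRing R] {N : ℕ} (x : Fin N → R) (j : Fin N) : Polynomial R :=
  ∏ l ∈ univ.erase j, (1 - Polynomial.C (x l) * Polynomial.X)

lemma Ej_natDegree {R : Type*} [CommRing R] {N : ℕ} (x : Fin N → R) (j : Fin N) :
    (Ej x j).natDegree < N := by
  have : (Ej x j).natDegree ≤ ∑ l ∈ univ.erase j, 1 := by
    refine (Polynomial.natDegree_prod_le _ _).trans ?_
    refine Finset.sum_le_sum fun b _ => ?_
    compute_degree
  rw [sum_const, card_erase_of_mem (mem_univ _), card_univ, Fintype.card_fin, smul_eq_mul, mul_one] at this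
  have := j.2
  omega

lemma pow_eq_sum {R : Type*} [CommRing R] {N : ℕ} (x : Fin N → R) (j : Fin N) (e : ℕ) :
    x j ^ e = ∑ q : Fin N, hz (hx x) ((e : ℤ) - (q : ℕ)) * (Ej x j).coeff q := by
  have h1 : (∏ j, PowerSeries.mk fun k => x j ^ k) * ((Ej x j : Polynomial R) : PowerSeries R) =
      PowerSeries.mk fun k => x j ^ k := by
    rw [← mul_prod_erase univ _ (mem_univ j)]
    have : ((Ej x j : Polynomial R) : PowerSeries R) =
        ∏ l ∈ univ.erase j, (1 - PowerSeries.C (x l) * PowerSeries.X) := by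
      unfold Ej
      rw [← Polynomial.coeToPowerSeries.ringHom_apply, map_prod]
      simp
    rw [this, mul_assoc, ← prod_mul_distrib, prod_congr rfl fun l _ => mk_pow_mul (x l)]
    simp
  have h2 := congrArg (PowerSeries.coeff e) h1
  rw [PowerSeries.coeff_mul, PowerSeries.coeff_mk] at h2
  rw [← h2, Finset.Nat.sum_antidiagonal_eq_sum_range_succ_mk, ← Finset.sum_range_reflect]
  simp only [Polynomial.coeff_coe]
  change ∑ q ∈ range (e + 1), hx x (e + 1 - 1 - q) * (Ej x j).coeff (e - (e + 1 - 1 - q)) = _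
  rw [Fin.sum_univ_eq_sum_range (fun q => hz (hx x) ((e : ℤ) - (q : ℕ)) * (Ej x j).coeff q) N]
  have h3 : ∀ q ∈ range (e + 1), hx x (e + 1 - 1 - q) * (Ej x j).coeff (e - (e + 1 - 1 - q)) =
      hz (hx x) ((e : ℤ) - (q : ℕ)) * (Ej x j).coeff q := by
    intro q hq
    have hq' := mem_range.mp hq
    rw [show (e : ℤ) - (q : ℕ) = ((e + 1 - 1 - q : ℕ) : ℤ) by omega, hz_nat,
      show e - (e + 1 - 1 - q) = q by omega]
  rw [sum_congr rfl h3]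
  have h4 : ∀ q, e + 1 ≤ q → hz (hx x) ((e : ℤ) - (q : ℕ)) * (Ej x j).coeff q = 0 := by
    intro q hq
    rw [hz_neg (by omega), zero_mul]
  have h5 : ∀ q, N ≤ q → hz (hx x) ((e : ℤ) - (q : ℕ)) * (Ej x j).coeff q = 0 := by
    intro q hq
    rw [Polynomial.coeff_eq_zero_of_natDegree_lt ((Ej_natDegree x j).trans_le hq), mul_zero]
  rcases le_total (e + 1) N with h | h
  · exact sum_subset (range_subset_range.mpr h) fun q _ hq => h4 q (by simpa using hq)
  · exact (sum_subset (range_subset_range.mpr h) fun q _ hq => h5 q (by simpa using hq)).symm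

lemma bialt {R : Type*} [CommRing R] {N : ℕ} (x : Fin N → R) (l : YoungDiagram) :
    alt x (ee N l) = sN N (hx x) l * alt x (ee N ⊥) := by
  have key : ∀ l : YoungDiagram, alt x (ee N l) = sN N (hx x) l *
      Matrix.det (Matrix.of fun q j : Fin N => (Ej x j).coeff (q.rev : ℕ)) := by
    intro l
    unfold sN JT
    rw [← Matrix.det_mul]
    unfold alt
    congr 1
    ext i j
    rw [Matrix.mul_apply, Matrix.of_apply, pow_eq_sum, ← Equiv.sum_comp Fin.revPerm]
    refine sum_congr rfl fun q _ => ?_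
    simp only [Matrix.of_apply, Fin.revPerm_apply]
    congr 2
    unfold ee ya
    have := q.2
    have := i.2
    simp only [Fin.val_rev]
    omega
  rw [key l, key ⊥, sN_bot N _ (hx_zero x), one_mul]

lemma bot_rowLen (i : ℕ) : (⊥ : YoungDiagram).rowLen i = 0 :=
  rowLen_eq_of_mem (by intro j; simp)

lemma alt_bot_ne {K : Type*} [Field K] {N : ℕ} (x : Fin N → K) (hx : Function.Injective x) :
    alt x (ee N ⊥) ≠ 0 := by
  have : alt x (ee N ⊥) = (Matrix.projVandermonde (fun _ => 1) x).det := by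
    rw [← Matrix.det_transpose]
    unfold alt
    congr 1
    ext i j
    simp [ee, bot_rowLen, Matrix.projVandermonde_apply]
  rw [this, Matrix.det_projVandermonde, prod_ne_zero_iff]
  intro i _
  rw [prod_ne_zero_iff]
  intro j hj
  have := (mem_Ioi.mp hj).ne
  rw [one_mul, one_mul, sub_ne_zero]
  exact fun h => this (hx h)

lemma hx_map {R S : Type*} [CommRing R] [CommRing S] (f : R →+* S) {N : ℕ} (x : Fin N → R)
    (k : ℕ) : f (hx x k) = hx (fun j => f (x j)) k := by
  unfold hx
  rw [← PowerSeries.coeff_map, map_prod]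
  congr 2
  funext j
  ext k
  simp

end HWF

namespace HWF
open Finset

lemma lt_frobRank (l : YoungDiagram) (k : ℕ) : k < frobRank l ↔ (k, k) ∈ l := by
  classical
  have hex : ∃ k, (k, k) ∉ l := by
    refine ⟨l.cells.card, fun h => ?_⟩
    have := rowLen_card l
    have h2 := YoungDiagram.mem_iff_lt_rowLen.mp h
    omega
  have h1 : ∀ k, (k, k) ∈ l ↔ k < Nat.find hex := by
    intro k
    rw [Nat.lt_find_iff]
    simp only [not_not]
    exact ⟨fun h m hm => l.isLowerSet (by simpa using hm) h, fun h => h k le_rfl⟩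
  have h2 : frobRank l = Nat.find hex := by
    unfold frobRank
    have : (l.cells.filter fun c => c.1 = c.2) = (range (Nat.find hex)).image fun k => (k, k) := by
      ext ⟨i, j⟩
      simp only [mem_filter, mem_image, mem_range, YoungDiagram.mem_cells, Prod.mk.injEq]
      constructor
      · rintro ⟨h, rfl⟩
        exact ⟨i, (h1 i).mp h, rfl, rfl⟩
      · rintro ⟨k, hk, rfl, rfl⟩
        exact ⟨(h1 k).mpr hk, rfl⟩
    rw [this, card_image_of_injective, card_range]
    intro a b h
    exact (Prod.mk.inj h).1
  rw [h2, h1]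

lemma mem_frobSet (p : ℕ) (l : YoungDiagram) :
    l ∈ frobSet p ↔ ∀ k, (k, k) ∈ l → l.rowLen k = l.colLen k + p := by
  unfold frobSet
  simp only [Set.mem_ofPred_eq, lt_frobRank]

/-- Diagonal shift of cells. -/
def shiftC (c : ℕ × ℕ) : ℕ × ℕ := (c.1 + 1, c.2 + 1)

lemma shiftC_inj : Function.Injective shiftC := by
  intro a b h
  simpa [Prod.ext_iff, shiftC] using h

/-- Remove the first row and the first column. -/
def unhook (l : YoungDiagram) : YoungDiagram where
  cells := l.cells.preimage shiftC shiftC_inj.injOn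
  isLowerSet := by
    intro a b hab ha
    rw [mem_coe, Finset.mem_preimage] at ha ⊢
    exact l.isLowerSet (show (b.1 + 1, b.2 + 1) ≤ (a.1 + 1, a.2 + 1) by
      simpa [Prod.le_def] using hab) ha

lemma mem_unhook {l : YoungDiagram} {i j : ℕ} : (i, j) ∈ unhook l ↔ (i + 1, j + 1) ∈ l := by
  rw [← YoungDiagram.mem_cells]
  unfold unhook
  rw [Finset.mem_preimage]; rfl

lemma unhook_rowLen (l : YoungDiagram) (i : ℕ) : (unhook l).rowLen i = l.rowLen (i + 1) - 1 := by
  apply rowLen_eq_of_mem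
  intro j
  rw [mem_unhook, YoungDiagram.mem_iff_lt_rowLen]
  omega

lemma unhook_colLen (l : YoungDiagram) (i : ℕ) : (unhook l).colLen i = l.colLen (i + 1) - 1 := by
  have h : ∀ j, j < (unhook l).colLen i ↔ j < l.colLen (i + 1) - 1 := by
    intro j
    rw [← YoungDiagram.mem_iff_lt_colLen, mem_unhook, YoungDiagram.mem_iff_lt_colLen]
    omega
  have a := h ((unhook l).colLen i)
  have b := h (l.colLen (i + 1) - 1)
  omega

lemma unhook_frobRank (l : YoungDiagram) : frobRank (unhook l) = frobRank l - 1 := by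
  have h : ∀ j, j < frobRank (unhook l) ↔ j < frobRank l - 1 := by
    intro j
    rw [lt_frobRank, mem_unhook, ← lt_frobRank]
    omega
  have a := h (frobRank (unhook l))
  have b := h (frobRank l - 1)
  omega

lemma colLen_le_of_rowLen {l : YoungDiagram} {N : ℕ} (h : l.rowLen N = 0) (c : ℕ) :
    l.colLen c ≤ N := by
  by_contra hc
  have := YoungDiagram.mem_iff_lt_colLen.mpr (not_le.mp hc)
  have := YoungDiagram.mem_iff_lt_rowLen.mp this
  omega

lemma rowLen_le_of_frob {l : YoungDiagram} {N p : ℕ} (h : l.rowLen N = 0) (hl : l ∈ frobSet p) :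
    l.rowLen 0 ≤ N + p := by
  by_cases h0 : (0, 0) ∈ l
  · rw [(mem_frobSet p l).mp hl 0 h0]
    have := colLen_le_of_rowLen h 0
    omega
  · rw [YoungDiagram.mem_iff_lt_rowLen] at h0
    omega

lemma card_le_box {l : YoungDiagram} {N M : ℕ} (h : l.rowLen N = 0) (h0 : l.rowLen 0 ≤ M) :
    l.cells.card ≤ N * M := by
  rw [card_eq_sum_rowLen h]
  refine (sum_le_sum fun (i : Fin N) _ => (l.rowLen_anti 0 i (Nat.zero_le _)).trans h0).trans ?_
  simp

open Classical in
/-- The finite set of elements of `frobSet p` with at most `N` rows. -/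
def PF (p N : ℕ) : Finset YoungDiagram :=
  ((range (N * (N + p) + 1)).biUnion parts).filter fun l => l ∈ frobSet p ∧ l.rowLen N = 0

lemma mem_PF {p N : ℕ} {l : YoungDiagram} : l ∈ PF p N ↔ l ∈ frobSet p ∧ l.rowLen N = 0 := by
  unfold PF
  simp only [mem_filter, mem_biUnion, mem_range, mem_parts, and_iff_right_iff_imp]
  rintro ⟨h1, h2⟩
  exact ⟨_, Nat.lt_succ_of_le (card_le_box h2 (rowLen_le_of_frob h2 h1)), rfl⟩

/-- The sign of an element of `frobSet p`. -/
def sg (p : ℕ) (l : YoungDiagram) : ℤ := (-1) ^ ((l.cells.card + frobRank l - frobRank l * p) / 2)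

section hook
variable {p N : ℕ} {l : YoungDiagram}

lemma hook_facts (hl : l ∈ frobSet p) (h1 : l.rowLen (N + 1) = 0) (h2 : l.rowLen N ≠ 0) :
    l.colLen 0 = N + 1 ∧ l.rowLen 0 = N + 1 + p ∧ (∀ i ≤ N, 0 < l.rowLen i) ∧
      0 < frobRank l := by
  have hpos : ∀ i ≤ N, 0 < l.rowLen i := fun i hi => by
    have := l.rowLen_anti i N hi
    omega
  have hc : l.colLen 0 = N + 1 := by
    apply le_antisymm (colLen_le_of_rowLen h1 0)
    have := YoungDiagram.mem_iff_lt_colLen.mp (YoungDiagram.mem_iff_lt_rowLen.mpr (hpos N le_rfl))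
    omega
  have h0 : (0, 0) ∈ l := YoungDiagram.mem_iff_lt_rowLen.mpr (hpos 0 (Nat.zero_le _))
  refine ⟨hc, ?_, hpos, (lt_frobRank l 0).mpr h0⟩
  rw [(mem_frobSet p l).mp hl 0 h0, hc]

lemma unhook_mem (hl : l ∈ frobSet p) (h1 : l.rowLen (N + 1) = 0) :
    unhook l ∈ PF p N := by
  rw [mem_PF]
  refine ⟨?_, by rw [unhook_rowLen, h1]⟩
  rw [mem_frobSet] at hl ⊢
  intro k hk
  rw [unhook_rowLen, unhook_colLen]
  rw [mem_unhook] at hk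
  have := hl _ hk
  have := YoungDiagram.mem_iff_lt_colLen.mp hk
  omega

lemma unhook_card (hl : l ∈ frobSet p) (h1 : l.rowLen (N + 1) = 0) (h2 : l.rowLen N ≠ 0) :
    l.cells.card = (unhook l).cells.card + (2 * N + 1 + p) := by
  obtain ⟨_, h0, hpos, _⟩ := hook_facts hl h1 h2
  rw [card_eq_sum_rowLen h1, card_eq_sum_rowLen (l := unhook l) (N := N)
    (by rw [unhook_rowLen, h1]), Fin.sum_univ_succ]
  have : ∀ i : Fin N, l.rowLen (i.succ : ℕ) = (unhook l).rowLen i + 1 := by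
    intro i
    have := hpos (i + 1) i.2
    rw [unhook_rowLen, Fin.val_succ]; omega
  rw [sum_congr rfl fun i _ => this i, sum_add_distrib]
  simp [h0]; ring

lemma frob_parity (N : ℕ) : ∀ l ∈ PF p N,
    ∃ t, l.cells.card + frobRank l = frobRank l * p + 2 * t := by
  induction N with
  | zero =>
    intro l hl
    have h0 := (mem_PF.mp hl).2
    have hr : frobRank l = 0 := by
      by_contra h
      have := (lt_frobRank l 0).mp (Nat.pos_of_ne_zero h)
      rw [YoungDiagram.mem_iff_lt_rowLen] at this
      omega
    refine ⟨0, ?_⟩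
    rw [hr, card_eq_sum_rowLen h0]; simp
  | succ N ih =>
    intro l hl
    obtain ⟨hf, h1⟩ := mem_PF.mp hl
    by_cases h2 : l.rowLen N = 0
    · exact ih l (mem_PF.mpr ⟨hf, h2⟩)
    · obtain ⟨t, ht⟩ := ih _ (unhook_mem hf h1)
      have hc := unhook_card hf h1 h2
      have hr := unhook_frobRank l
      obtain ⟨_, _, _, h3⟩ := hook_facts hf h1 h2
      obtain ⟨r, hr2⟩ : ∃ r, frobRank l = r + 1 := ⟨frobRank l - 1, by omega⟩
      rw [hr2] at hr ⊢
      rw [Nat.add_sub_cancel] at hr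
      rw [hr] at ht
      refine ⟨t + (N + 1), ?_⟩
      rw [hc]; linarith

lemma sg_eq {t : ℕ} (h : l.cells.card + frobRank l = frobRank l * p + 2 * t) :
    sg p l = (-1) ^ t := by
  unfold sg
  congr 1
  omega

lemma sg_unhook (hl : l ∈ frobSet p) (h1 : l.rowLen (N + 1) = 0) (h2 : l.rowLen N ≠ 0) :
    sg p l = (-1) ^ (N + 1) * sg p (unhook l) := by
  obtain ⟨t, ht⟩ := frob_parity N _ (unhook_mem hl h1)
  rw [sg_eq ht, ← pow_add]
  apply sg_eq
  have hc := unhook_card hl h1 h2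
  have hr := unhook_frobRank l
  obtain ⟨_, _, _, h3⟩ := hook_facts hl h1 h2
  obtain ⟨r, hr2⟩ : ∃ r, frobRank l = r + 1 := ⟨frobRank l - 1, by omega⟩
  rw [hr2] at hr ⊢
  rw [Nat.add_sub_cancel] at hr
  rw [hr] at ht
  rw [hc]; linarith

lemma exists_hook {t : YoungDiagram} (ht : t ∈ PF p N) :
    ∃ l, l ∈ PF p (N + 1) ∧ l.rowLen N ≠ 0 ∧ unhook l = t := by
  obtain ⟨hf, h0⟩ := mem_PF.mp ht
  have hb := rowLen_le_of_frob h0 hf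
  obtain ⟨l, h1, h2⟩ := exists_yd (N := N + 1) (fun i => if (i : ℕ) = 0 then N + 1 + p else
      t.rowLen (i - 1) + 1) (by
    intro i j hij
    have hij' : (i : ℕ) ≤ j := hij
    dsimp only
    split_ifs with h3 h4 h4
    · omega
    · omega
    · have := t.rowLen_anti 0 (j - 1) (Nat.zero_le _)
      omega
    · have := t.rowLen_anti (i - 1) (j - 1) (by omega)
      omega)
  have g0 : l.rowLen 0 = N + 1 + p := by simpa using h2 0
  have g1 : ∀ i < N, l.rowLen (i + 1) = t.rowLen i + 1 := by
    intro i hi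
    simpa using h2 ⟨i + 1, by omega⟩
  have gN : l.rowLen N ≠ 0 := by
    rcases N with _ | N
    · omega
    · have := g1 N (by omega)
      omega
  have hu : unhook l = t := by
    apply yd_ext_fin (N := N) (by rw [unhook_rowLen, h1]) h0
    intro i
    rw [unhook_rowLen, g1 _ i.2]; simp
  refine ⟨l, ?_, gN, hu⟩
  rw [mem_PF]
  refine ⟨?_, h1⟩
  rw [mem_frobSet] at hf ⊢
  have gpos : ∀ i ≤ N, 0 < l.rowLen i := fun i hi => by
    have := l.rowLen_anti i N hi
    omega
  intro k hk
  rcases k with _ | k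
  · rw [g0]
    have hc : l.colLen 0 = N + 1 := by
      apply le_antisymm (colLen_le_of_rowLen h1 0)
      have := YoungDiagram.mem_iff_lt_colLen.mp
        (YoungDiagram.mem_iff_lt_rowLen.mpr (gpos N le_rfl))
      omega
    omega
  · have hk2 := hk
    rw [← mem_unhook, hu] at hk
    have := hf _ hk
    rw [← hu, unhook_rowLen, unhook_colLen] at this
    have := YoungDiagram.mem_iff_lt_colLen.mp hk2
    have := YoungDiagram.mem_iff_lt_rowLen.mp hk2
    omega

lemma unhook_inj {l l' : YoungDiagram} (hl : l ∈ PF p (N + 1)) (hl' : l' ∈ PF p (N + 1))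
    (h : l.rowLen N ≠ 0) (h' : l'.rowLen N ≠ 0) (e : unhook l = unhook l') : l = l' := by
  obtain ⟨hf, h1⟩ := mem_PF.mp hl
  obtain ⟨hf', h1'⟩ := mem_PF.mp hl'
  obtain ⟨_, a0, apos, _⟩ := hook_facts hf h1 h
  obtain ⟨_, b0, bpos, _⟩ := hook_facts hf' h1' h'
  apply yd_ext_fin h1 h1'
  intro i
  refine Fin.cases ?_ (fun i => ?_) i
  · simpa [a0] using b0.symm
  · have := congrArg (fun q => YoungDiagram.rowLen q i) e
    simp only [unhook_rowLen] at this
    have := apos (i + 1) i.2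
    have := bpos (i + 1) i.2
    rw [Fin.val_succ]; omega

end hook

lemma alt_last {R : Type*} [CommRing R] {N : ℕ} (x : Fin (N + 1) → R) {l : YoungDiagram}
    (h : l.rowLen N = 0) :
    alt x (ee (N + 1) l) = ∑ j : Fin (N + 1), (-1) ^ (N + (j : ℕ)) *
      (∏ i : Fin N, x (j.succAbove i)) * alt (fun i => x (j.succAbove i)) (ee N l) := by
  unfold alt
  rw [Matrix.det_succ_row _ (Fin.last N)]
  refine sum_congr rfl fun j _ => ?_
  rw [mul_assoc, mul_assoc, ← Matrix.det_mul_row]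
  congr 1
  rw [Matrix.of_apply, show ee (N + 1) l (Fin.last N) = 0 by simp [ee, h], pow_zero, one_mul]
  congr 1
  ext i k
  simp only [Matrix.submatrix_apply, Matrix.of_apply, Fin.succAbove_last, ee]
  rw [← pow_succ']
  congr 1
  have := i.2
  simp only [Fin.val_rev, Fin.val_castSucc]; omega

lemma alt_hook {R : Type*} [CommRing R] {N p : ℕ} (x : Fin (N + 1) → R) {l : YoungDiagram}
    (hl : l ∈ frobSet p) (h1 : l.rowLen (N + 1) = 0) (h2 : l.rowLen N ≠ 0) :
    alt x (ee (N + 1) l) = ∑ j : Fin (N + 1), (-1) ^ (j : ℕ) * x j ^ (2 * N + 1 + p) *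
      (∏ i : Fin N, x (j.succAbove i)) * alt (fun i => x (j.succAbove i)) (ee N (unhook l)) := by
  obtain ⟨_, h0, hpos, _⟩ := hook_facts hl h1 h2
  have : ee (N + 1) l = Fin.cons (2 * N + 1 + p) (fun i => ee N (unhook l) i + 1) := by
    funext i
    refine Fin.cases ?_ (fun i => ?_) i
    · simp [ee, h0]; ring
    · have := hpos (i + 1) i.2
      have := i.2
      simp only [Fin.cons_succ, ee, unhook_rowLen, Fin.val_rev, Fin.val_succ]
      omega
  rw [this, alt_cons]
  refine sum_congr rfl fun j _ => ?_
  unfold alt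
  rw [mul_assoc _ (∏ i : Fin N, x (j.succAbove i)), ← Matrix.det_mul_row]
  congr 2
  ext i k
  simp [pow_succ']

lemma GG_last {R : Type*} [CommRing R] {N p : ℕ} (x : Fin (N + 1) → R) :
    GG x (fun j => x j ^ (N + 1 + p)) = ∑ j : Fin (N + 1), (-1) ^ (N + (j : ℕ)) *
      (1 - x j ^ (2 * N + 1 + p)) *
      (∏ i : Fin N, x (j.succAbove i)) * GG (fun i => x (j.succAbove i))
        (fun i => x (j.succAbove i) ^ (N + p)) := by
  unfold GG
  rw [Matrix.det_succ_column _ (Fin.last N)]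
  refine sum_congr rfl fun j _ => ?_
  rw [mul_assoc _ (∏ i : Fin N, x (j.succAbove i)), ← Matrix.det_mul_column]
  congr 1
  · rw [Matrix.of_apply]
    simp only [Fin.rev_last, Fin.val_last, Fin.val_zero, pow_zero, ← pow_add]
    rw [show N + 1 + p + N = 2 * N + 1 + p by ring, add_comm N]
  · congr 1
    ext i k
    simp only [Matrix.submatrix_apply, Matrix.of_apply, Fin.succAbove_last, ← pow_add]
    rw [mul_sub, ← pow_succ', ← pow_succ']
    have := k.2
    congr 2
    · simp only [Fin.val_rev, Fin.val_castSucc]; omega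
    · simp only [Fin.val_castSucc]; omega

lemma GG_eq_sum_PF {R : Type*} [CommRing R] (p : ℕ) {N : ℕ} : ∀ (x : Fin N → R),
    GG x (fun j => x j ^ (N + p)) = ∑ l ∈ PF p N, (sg p l : R) * alt x (ee N l) := by
  classical
  induction N with
  | zero =>
    intro x
    have : PF p 0 = {⊥} := by
      ext l
      rw [mem_PF, mem_singleton]
      constructor
      · rintro ⟨_, h⟩
        exact yd_ext_fin h (bot_rowLen 0) (fun i => i.elim0)
      · rintro rfl
        refine ⟨?_, bot_rowLen 0⟩
        rw [mem_frobSet]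
        intro k hk
        simp at hk
    have h0 : frobRank ⊥ = 0 := by simp [frobRank]
    simp [this, GG, alt, sg, h0]
  | succ N ih =>
    intro x
    rw [GG_last, ← sum_filter_add_sum_filter_not (PF p (N + 1)) (fun l => l.rowLen N = 0)]
    have e1 : (PF p (N + 1)).filter (fun l => l.rowLen N = 0) = PF p N := by
      ext l
      simp only [mem_filter, mem_PF]
      exact ⟨fun h => ⟨h.1.1, h.2⟩,
        fun h => ⟨⟨h.1, rowLen_zero_of_le h.2 (Nat.le_succ N)⟩, h.2⟩⟩
    have e2 : ∑ l ∈ (PF p (N + 1)).filter (fun l => ¬ l.rowLen N = 0),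
        (sg p l : R) * alt x (ee (N + 1) l) = ∑ t ∈ PF p N, (-1) ^ (N + 1) * (sg p t : R) *
        ∑ j : Fin (N + 1), (-1) ^ (j : ℕ) * x j ^ (2 * N + 1 + p) *
      (∏ i : Fin N, x (j.succAbove i)) * alt (fun i => x (j.succAbove i)) (ee N t) := by
      refine sum_bij (fun l _ => unhook l) ?_ ?_ ?_ ?_
      · intro l hl
        obtain ⟨hl, _⟩ := mem_filter.mp hl
        obtain ⟨hf, h1⟩ := mem_PF.mp hl
        exact unhook_mem hf h1
      · intro l hl l' hl' e
        obtain ⟨hl, h⟩ := mem_filter.mp hl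
        obtain ⟨hl', h'⟩ := mem_filter.mp hl'
        exact unhook_inj hl hl' h h' e
      · intro t ht
        obtain ⟨l, h1, h2, h3⟩ := exists_hook ht
        exact ⟨l, mem_filter.mpr ⟨h1, h2⟩, h3⟩
      · intro l hl
        obtain ⟨hl, h2⟩ := mem_filter.mp hl
        obtain ⟨hf, h1⟩ := mem_PF.mp hl
        rw [alt_hook x hf h1 h2, sg_unhook hf h1 h2]
        push_cast
        rfl
    have e3 : ∑ l ∈ PF p N, (sg p l : R) * alt x (ee (N + 1) l) =
        ∑ l ∈ PF p N, (sg p l : R) * ∑ j : Fin (N + 1), (-1) ^ (N + (j : ℕ)) *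
      (∏ i : Fin N, x (j.succAbove i)) * alt (fun i => x (j.succAbove i)) (ee N l) := by
      refine sum_congr rfl fun l hl => ?_
      rw [alt_last x (mem_PF.mp hl).2]
    rw [e1, e2, e3, ← sum_add_distrib]
    simp_rw [ih, mul_sum, ← sum_add_distrib]
    rw [sum_comm]
    refine sum_congr rfl fun l _ => sum_congr rfl fun j _ => ?_
    ring

end HWF

namespace HWF
open Finset

open Classical in
/-- Diagrams in the `N × p` box. -/
def BX (p N : ℕ) : Finset YoungDiagram :=
  ((range (N * p + 1)).biUnion parts).filter fun l => l.rowLen 0 ≤ p ∧ l.rowLen N = 0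

lemma mem_BX {p N : ℕ} {l : YoungDiagram} : l ∈ BX p N ↔ l.rowLen 0 ≤ p ∧ l.rowLen N = 0 := by
  unfold BX
  simp only [mem_filter, mem_biUnion, mem_range, mem_parts, and_iff_right_iff_imp]
  rintro ⟨h1, h2⟩
  exact ⟨_, Nat.lt_succ_of_le (card_le_box h2 h1), rfl⟩

lemma strictAnti_add {N : ℕ} {e : Fin N → ℕ} (he : StrictAnti e) :
    ∀ (k : ℕ) (i j : Fin N), (j : ℕ) = i + k → e j + k ≤ e i := by
  intro k
  induction k with
  | zero =>
    intro i j h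
    have : i = j := Fin.ext (by omega)
    rw [this]; omega
  | succ k ih =>
    intro i j h
    have hk : (i : ℕ) + k < N := by omega
    have h1 := ih i ⟨i + k, hk⟩ rfl
    have h2 : e j < e ⟨i + k, hk⟩ := he (show (⟨i + k, hk⟩ : Fin N) < j from
      Fin.lt_def.mpr (by simp only; omega))
    omega

lemma FF_eq_sum_BX {R : Type*} [CommRing R] {N : ℕ} (p : ℕ) (x : Fin N → R) :
    FF (N + p) x = ∑ l ∈ BX p N, alt x (ee N l) := by
  unfold FF
  symm
  refine sum_bij (fun l _ => ee N l) ?_ ?_ ?_ ?_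
  · intro l hl
    obtain ⟨h1, h2⟩ := mem_BX.mp hl
    rw [mem_SA]
    constructor
    · intro i
      have := l.rowLen_anti 0 i (Nat.zero_le _)
      have := i.2
      simp only [ee, Fin.val_rev]; omega
    · intro i j hij
      have hij' : (i : ℕ) < j := hij
      have := l.rowLen_anti i j hij'.le
      have := j.2
      simp only [ee, Fin.val_rev]; omega
  · intro l hl l' hl' e
    apply yd_ext_fin (mem_BX.mp hl).2 (mem_BX.mp hl').2
    intro i
    have := congrFun e i
    simp only [ee] at this; omega
  · intro e he
    obtain ⟨h1, h2⟩ := mem_SA.mp he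
    have hge : ∀ i : Fin N, (i.rev : ℕ) ≤ e i := by
      intro i
      have := i.2
      have := strictAnti_add h2 (i.rev : ℕ) i ⟨N - 1, by omega⟩ (by
        simp only [Fin.val_rev]; omega)
      omega
    obtain ⟨l, g1, g2⟩ := exists_yd (N := N) (fun i => e i - (i.rev : ℕ)) (by
      intro i j hij
      have hij' : (i : ℕ) ≤ j := hij
      have := strictAnti_add h2 (j - i : ℕ) i j (by omega)
      have := j.2
      have := hge j
      simp only [Fin.val_rev] at *
      omega)
    refine ⟨l, mem_BX.mpr ⟨?_, g1⟩, ?_⟩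
    · rcases N with _ | N
      · omega
      · have a := g2 0
        have b := h1 0
        simp only [Fin.val_rev, Fin.val_zero] at a
        omega
    · funext i
      have := g2 i
      have := hge i
      simp only [ee]; omega
  · intro l _; rfl

lemma main_field {K : Type*} [Field K] {N : ℕ} (p : ℕ) (x : Fin N → K)
    (hinj : Function.Injective x) (h1 : ∀ j, x j ≠ -1) :
    (∑ l ∈ BX p N, sN N (hx x) l) * (∑ l ∈ PF 0 N, (sg 0 l : K) * sN N (hx x) l) =
      ∑ l ∈ PF p N, (sg p l : K) * sN N (hx x) l := by
  have key : ∀ p, (∑ l ∈ BX p N, sN N (hx x) l) * DD x =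
      ∑ l ∈ PF p N, (sg p l : K) * sN N (hx x) l := by
    intro p
    apply mul_right_cancel₀ (alt_bot_ne x hinj)
    have h := FF_DD (N + p) x hinj h1
    rw [GG_eq_sum_PF, FF_eq_sum_BX] at h
    rw [mul_right_comm, sum_mul _ _ (alt x (ee N ⊥)), sum_mul _ _ (alt x (ee N ⊥))]
    rw [sum_congr rfl fun l _ => (bialt x l).symm, h]
    refine sum_congr rfl fun l _ => ?_
    rw [bialt x l, mul_assoc]
  have h0 := key 0
  have : BX 0 N = {⊥} := by
    ext l
    rw [mem_BX, mem_singleton]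
    constructor
    · rintro ⟨h, h'⟩
      exact yd_ext_fin (N := 0) (by omega) (bot_rowLen 0) (fun i => i.elim0)
    · rintro rfl
      exact ⟨(bot_rowLen 0).le, bot_rowLen N⟩
  rw [this, sum_singleton, sN_bot N _ (hx_zero x), one_mul] at h0
  rw [← h0, key]

lemma main_ring {R : Type*} [CommRing R] {N : ℕ} (p : ℕ) (x : Fin N → R) :
    (∑ l ∈ BX p N, sN N (hx x) l) * (∑ l ∈ PF 0 N, (sg 0 l : R) * sN N (hx x) l) =
      ∑ l ∈ PF p N, (sg p l : R) * sN N (hx x) l := by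
  let P := MvPolynomial (Fin N) ℤ
  let F := FractionRing P
  have hinjF : Function.Injective (algebraMap P F) := IsFractionRing.injective P F
  have hF := main_field (K := F) p (fun j => algebraMap P F (MvPolynomial.X j))
    (fun i j h => MvPolynomial.X_injective (hinjF h)) (by
      intro j h
      rw [← map_one (algebraMap P F), ← map_neg] at h
      have h2 := congrArg (MvPolynomial.eval fun _ => (0 : ℤ)) (hinjF h)
      simp at h2)
  have hP : (∑ l ∈ BX p N, sN N (hx (MvPolynomial.X : Fin N → P)) l) *
      (∑ l ∈ PF 0 N, (sg 0 l : P) * sN N (hx (MvPolynomial.X : Fin N → P)) l) =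
      ∑ l ∈ PF p N, (sg p l : P) * sN N (hx (MvPolynomial.X : Fin N → P)) l := by
    apply hinjF
    simp only [map_mul, map_sum, map_intCast]
    simpa only [sN_map, hx_map] using hF
  have := congrArg (MvPolynomial.eval₂Hom (Int.castRingHom R) x) hP
  simp only [map_mul, map_sum, map_intCast] at this
  simpa only [sN_map, hx_map, MvPolynomial.coe_eval₂Hom, MvPolynomial.eval₂_X] using this

end HWF

namespace HWF
open Finset

lemma sN_stab_succ {R : Type*} [CommRing R] {N : ℕ} {h : ℕ → R} (h0 : h 0 = 1)
    {l : YoungDiagram} (hl : l.rowLen N = 0) : sN (N + 1) h l = sN N h l := by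
  unfold sN JT
  rw [Matrix.det_succ_row _ (Fin.last N), Finset.sum_eq_single (Fin.last N)]
  · have : hz h (ya (N + 1) l (Fin.last N) + ((Fin.last N : Fin (N + 1)) : ℕ)) = 1 := by
      simp [ya, hl, hz, h0]
    rw [Matrix.of_apply, this]
    have e : (-1 : R) ^ (((Fin.last N : Fin (N + 1)) : ℕ) + ((Fin.last N : Fin (N + 1)) : ℕ)) = 1 :=
      Even.neg_one_pow ⟨_, rfl⟩
    rw [e, one_mul, one_mul]
    congr 1
    ext i j
    simp [ya]
  · intro j _ hj
    have hj' : (j : ℕ) < N := Fin.val_lt_last hj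
    rw [Matrix.of_apply, hz_neg, mul_zero, zero_mul]
    simp only [ya, Fin.val_last, hl]; omega
  · simp

lemma sN_stab {R : Type*} [CommRing R] {N M : ℕ} {h : ℕ → R} (h0 : h 0 = 1)
    {l : YoungDiagram} (hl : l.rowLen N = 0) (hNM : N ≤ M) : sN M h l = sN N h l := by
  induction M, hNM using Nat.le_induction with
  | base => rfl
  | succ M hM ih => rw [sN_stab_succ h0 (rowLen_zero_of_le hl hM), ih]

/-- Intrinsic Schur function. -/
def sS {R : Type*} [CommRing R] (h : ℕ → R) (l : YoungDiagram) : R := sN l.cells.card h l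

lemma sN_eq_sS {R : Type*} [CommRing R] {N : ℕ} {h : ℕ → R} (h0 : h 0 = 1)
    {l : YoungDiagram} (hl : l.rowLen N = 0) : sN N h l = sS h l := by
  unfold sS
  rcases le_total N l.cells.card with H | H
  · exact (sN_stab h0 hl H).symm
  · exact sN_stab h0 (rowLen_card l) H

lemma sS_congr {R : Type*} [CommRing R] {M : ℕ} {h h' : ℕ → R} (e : ∀ k ≤ M, h k = h' k)
    {l : YoungDiagram} (hl : 2 * l.cells.card ≤ M) : sS h l = sS h' l := by
  unfold sS sN JT
  congr 1
  ext i j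
  simp only [Matrix.of_apply, hz]
  split_ifs with H
  · apply e
    unfold ya
    have : l.rowLen i ≤ l.cells.card := by
      refine le_of_le_of_eq ?_ (card_eq_sum_rowLen (rowLen_card l)).symm
      exact single_le_sum (f := fun i : Fin l.cells.card => l.rowLen i) (fun _ _ => Nat.zero_le _)
        (mem_univ i)
    have := j.2
    omega
  · rfl

lemma sS_map {R S : Type*} [CommRing R] [CommRing S] (f : R →+* S) (h : ℕ → R)
    (l : YoungDiagram) : f (sS h l) = sS (fun k => f (h k)) l := sN_map f _ h l

lemma hx_scale {R : Type*} [CommRing R] {N : ℕ} (a : Fin N → R) (k : ℕ) :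
    hx (fun j => Polynomial.C (a j) * Polynomial.X) k =
      Polynomial.C (hx a k) * Polynomial.X ^ k := by
  have h1 := hx_map (Polynomial.C : R →+* Polynomial R) a k
  rw [h1]
  unfold hx
  rw [mul_comm, ← PowerSeries.coeff_rescale, map_prod (PowerSeries.rescale Polynomial.X)]
  congr 2
  funext j
  rw [PowerSeries.rescale_mk]
  ext k
  simp only [PowerSeries.coeff_mk, mul_pow]
  ring_nf

lemma sN_scale {R : Type*} [CommRing R] {N : ℕ} (h : ℕ → R) {l : YoungDiagram}
    (hl : l.rowLen N = 0) :
    sN N (fun k => Polynomial.C (h k) * Polynomial.X ^ k) l =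
      Polynomial.C (sN N h l) * Polynomial.X ^ l.cells.card := by
  have e : (∏ i : Fin N, (Polynomial.X : Polynomial R) ^ (i : ℕ)) *
      sN N (fun k => Polynomial.C (h k) * Polynomial.X ^ k) l =
      (∏ i : Fin N, (Polynomial.X : Polynomial R) ^ (l.rowLen i)) *
      ((∏ j : Fin N, (Polynomial.X : Polynomial R) ^ (j : ℕ)) * Polynomial.C (sN N h l)) := by
    rw [sN_map]
    unfold sN JT
    conv_lhs => rw [← Matrix.det_mul_column]
    conv_rhs => rw [← Matrix.det_mul_row, ← Matrix.det_mul_column]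
    congr 1
    ext1 i j
    simp only [Matrix.of_apply, hz]
    split_ifs with H
    · have : (i : ℕ) + (ya N l i + (j : ℕ)).toNat = l.rowLen i + j := by
        unfold ya at *
        omega
      rw [mul_left_comm, ← pow_add, this, pow_add]; ring
    · simp
  rw [card_eq_sum_rowLen hl, ← Finset.prod_pow_eq_pow_sum]
  rw [Finset.prod_pow_eq_pow_sum univ (fun i : Fin N => (i : ℕ))] at e
  apply (Polynomial.monic_X_pow (R := R) (∑ i : Fin N, (i : ℕ))).isRegular.left
  simp only
  rw [e]; ring

end HWF

namespace HWF
open Finset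

lemma reflect_prod {R : Type*} [CommRing R] {N : ℕ} : ∀ (a : Fin N → R),
    Polynomial.reflect N (∏ j, (Polynomial.X - Polynomial.C (a j))) =
      ∏ j, (1 - Polynomial.C (a j) * Polynomial.X) := by
  induction N with
  | zero => intro a; simp [Polynomial.reflect_one]
  | succ N ih =>
    intro a
    rw [Fin.prod_univ_castSucc, Fin.prod_univ_castSucc, Polynomial.reflect_mul, ih]
    · congr 1
      rw [Polynomial.reflect_sub, Polynomial.reflect_one_X, Polynomial.reflect_C, pow_one]
    · refine (Polynomial.natDegree_prod_le _ _).trans ?_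
      refine (Finset.sum_le_sum fun b _ => Polynomial.natDegree_X_sub_C_le _).trans ?_
      simp
    · exact Polynomial.natDegree_X_sub_C_le _

lemma exists_fin_of_card {L : Type*} {N : ℕ} (s : Multiset L) (hs : s.card = N) :
    ∃ a : Fin N → L, univ.val.map a = s := by
  subst hs
  induction s using Quotient.inductionOn with
  | h l =>
    refine ⟨fun i => l.get ⟨i, by simpa using i.2⟩, ?_⟩
    rw [Fin.univ_val_map]
    exact congrArg _ (List.ofFn_get l)

lemma exists_hx {L : Type*} [Field L] [IsAlgClosed L] (N : ℕ) (h : ℕ → L) (h0 : h 0 = 1) :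
    ∃ a : Fin N → L, ∀ k ≤ N, hx a k = h k := by
  set H : PowerSeries L := PowerSeries.mk h with hH
  have hc : PowerSeries.constantCoeff H ≠ 0 := by
    rw [← PowerSeries.coeff_zero_eq_constantCoeff_apply, hH, PowerSeries.coeff_mk, h0]
    exact one_ne_zero
  have hHG := PowerSeries.mul_inv_cancel H hc
  set G := H⁻¹ with hG
  have hG0 : PowerSeries.coeff 0 G = 1 := by
    have := congrArg PowerSeries.constantCoeff hHG
    rw [map_mul, map_one, ← PowerSeries.coeff_zero_eq_constantCoeff_apply,
      ← PowerSeries.coeff_zero_eq_constantCoeff_apply, hH, PowerSeries.coeff_mk, h0, one_mul] at this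
    exact this
  set t := PowerSeries.trunc (N + 1) G with ht
  have htc : ∀ k, t.coeff k = if k < N + 1 then PowerSeries.coeff k G else 0 := by
    intro k; rw [ht, PowerSeries.coeff_trunc]
  set q := Polynomial.reflect N t with hq
  have hqd : q.natDegree ≤ N := by
    rw [Polynomial.natDegree_le_iff_coeff_eq_zero]
    intro k hk
    rw [hq, Polynomial.coeff_reflect, Polynomial.revAt_eq_self_of_lt hk, htc, if_neg (by omega)]
  have hq1 : q.coeff N = 1 := by
    rw [hq, Polynomial.coeff_reflect, Polynomial.revAt_le le_rfl, Nat.sub_self, htc,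
      if_pos (by omega), hG0]
  have hqm : q.Monic := Polynomial.monic_of_natDegree_le_of_coeff_eq_one N hqd hq1
  have hqn : q.natDegree = N := by
    apply le_antisymm hqd
    apply Polynomial.le_natDegree_of_ne_zero
    rw [hq1]; exact one_ne_zero
  have hsp : q.Splits := IsAlgClosed.splits q
  obtain ⟨a, ha⟩ := exists_fin_of_card q.roots (hsp.natDegree_eq_card_roots.symm.trans hqn)
  have hprod : q = ∏ j, (Polynomial.X - Polynomial.C (a j)) := by
    rw [hsp.eq_prod_roots_of_monic hqm, ← ha, Multiset.map_map]
    rfl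
  have htp : t = ∏ j, (1 - Polynomial.C (a j) * Polynomial.X) := by
    rw [← reflect_prod, ← hprod, hq, Polynomial.reflect_reflect]
  have hHP : (∏ j, PowerSeries.mk fun k => a j ^ k) * (t : PowerSeries L) = 1 := by
    have : (t : PowerSeries L) = ∏ j, (1 - PowerSeries.C (a j) * PowerSeries.X) := by
      rw [htp, ← Polynomial.coeToPowerSeries.ringHom_apply, map_prod]
      simp
    rw [this, ← prod_mul_distrib, prod_congr rfl fun l _ => mk_pow_mul (a l)]
    simp
  refine ⟨a, fun k hk => ?_⟩
  set P := ∏ j, PowerSeries.mk fun k => a j ^ k with hP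
  have e1 : P = (P * H) * G := by rw [mul_assoc, hHG, mul_one]
  have e2 : H = (P * H) * (t : PowerSeries L) := by
    rw [mul_right_comm, hHP, one_mul]
  have : PowerSeries.coeff k ((P * H) * G) = PowerSeries.coeff k ((P * H) * (t : PowerSeries L)) := by
    rw [PowerSeries.coeff_mul, PowerSeries.coeff_mul]
    refine sum_congr rfl fun c hc => ?_
    have := mem_antidiagonal.mp hc
    rw [Polynomial.coeff_coe, htc, if_pos (by omega)]
  rw [← e1, ← e2] at this
  unfold hx
  rw [← hP, this, hH, PowerSeries.coeff_mk]

end HWF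

namespace HWF
open Finset

open Classical in
/-- Degree `d` part of a signed sum of Schur functions over a class of partitions. -/
def SP {R : Type*} [CommRing R] (h : ℕ → R) (P : YoungDiagram → Prop) (c : YoungDiagram → ℤ)
    (d : ℕ) : R :=
  ∑ l ∈ (parts d).filter P, (c l : R) * sS h l

lemma SP_map {R S : Type*} [CommRing R] [CommRing S] (f : R →+* S) (h : ℕ → R)
    (P : YoungDiagram → Prop) (c : YoungDiagram → ℤ) (d : ℕ) :
    f (SP h P c d) = SP (fun k => f (h k)) P c d := by
  unfold SP
  rw [map_sum]
  refine Finset.sum_congr rfl fun l _ => ?_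
  rw [map_mul, sS_map, map_intCast]

lemma coeff_sum {R : Type*} [CommRing R] {M : ℕ} (F : Finset YoungDiagram)
    (P : YoungDiagram → Prop) (hF : ∀ l, l ∈ F ↔ P l ∧ l.rowLen M = 0)
    (c : YoungDiagram → ℤ) (h : ℕ → R) (a : Fin M → R) (ha : ∀ k ≤ M, hx a k = h k)
    (e : ℕ) (he : 2 * e ≤ M) :
    Polynomial.coeff (∑ l ∈ F, (c l : Polynomial R) *
      sN M (hx (fun j => Polynomial.C (a j) * Polynomial.X)) l) e = SP h P c e := by
  classical
  have e1 : hx (fun j => Polynomial.C (a j) * Polynomial.X) =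
      fun k => Polynomial.C (hx a k) * Polynomial.X ^ k := by
    funext k; exact hx_scale a k
  rw [Polynomial.finsetSum_coeff, SP, e1]
  have e2 : ∀ l ∈ F, Polynomial.coeff ((c l : Polynomial R) *
      sN M (fun k => Polynomial.C (hx a k) * Polynomial.X ^ k) l) e =
      if l.cells.card = e then (c l : R) * sS h l else 0 := by
    intro l hl
    have hl0 := ((hF l).1 hl).2
    rw [sN_scale _ hl0, ← Polynomial.C_eq_intCast, Polynomial.coeff_C_mul,
      Polynomial.coeff_C_mul, Polynomial.coeff_X_pow]
    split_ifs with h1 h2 h2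
    · rw [mul_one, sN_eq_sS (hx_zero _) hl0, sS_congr ha (by omega)]
    · exact absurd h1.symm h2
    · exact absurd h2.symm h1
    · simp
  rw [Finset.sum_congr rfl e2, ← Finset.sum_filter]
  refine Finset.sum_congr ?_ fun _ _ => rfl
  ext l
  simp only [Finset.mem_filter, hF, mem_parts]
  constructor
  · rintro ⟨⟨h1, _⟩, h2⟩; exact ⟨h2, h1⟩
  · rintro ⟨h1, h2⟩
    exact ⟨⟨h2, rowLen_zero_of_le (rowLen_card l) (by omega)⟩, h1⟩

lemma key_L {L : Type*} [Field L] [IsAlgClosed L] (h : ℕ → L) (h0 : h 0 = 1) (p : ℕ) :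
    PowerSeries.mk (SP h (fun l => l.rowLen 0 ≤ p) (fun _ => 1)) *
      PowerSeries.mk (SP h (fun l => l ∈ frobSet 0) (sg 0)) =
      PowerSeries.mk (SP h (fun l => l ∈ frobSet p) (sg p)) := by
  ext d
  obtain ⟨a, ha⟩ := exists_hx (2 * d) h h0
  have main := congrArg (fun q => Polynomial.coeff q d)
    (main_ring p (fun j => Polynomial.C (a j) * Polynomial.X))
  beta_reduce at main
  rw [Polynomial.coeff_mul, coeff_sum (PF p (2 * d)) (fun l => l ∈ frobSet p)
    (fun l => mem_PF) (sg p) h a ha d le_rfl] at main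
  rw [PowerSeries.coeff_mul, PowerSeries.coeff_mk, ← main]
  refine Finset.sum_congr rfl fun z hz => ?_
  have hz' := Finset.HasAntidiagonal.mem_antidiagonal.1 hz
  rw [coeff_sum (PF 0 (2 * d)) (fun l => l ∈ frobSet 0)
    (fun l => mem_PF) (sg 0) h a ha z.2 (by omega)]
  have := coeff_sum (BX p (2 * d)) (fun l => l.rowLen 0 ≤ p)
    (fun l => mem_BX) (fun _ => 1) h a ha z.1 (by omega)
  simp only [Int.cast_one, one_mul] at this
  rw [this, PowerSeries.coeff_mk, PowerSeries.coeff_mk]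

lemma rowLen_zero_le_card (l : YoungDiagram) : l.rowLen 0 ≤ l.cells.card := by
  rw [card_eq_sum_rowLen (N := l.cells.card + 1) (rowLen_zero_of_le (rowLen_card l) (by omega))]
  rw [Fin.sum_univ_eq_sum_range (fun i => l.rowLen i)]
  exact Finset.single_le_sum (f := fun i => l.rowLen i) (fun _ _ => Nat.zero_le _) (Finset.mem_range.2 (Nat.succ_pos _))

lemma SP_frob_self {R : Type*} [CommRing R] (h : ℕ → R) (d : ℕ) :
    SP h (fun l => l ∈ frobSet d) (sg d) d = if d = 0 then SP h (fun l => l ∈ frobSet 0) (sg 0) 0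
      else 0 := by
  classical
  split_ifs with hd
  · subst hd; rfl
  · rw [SP, Finset.sum_eq_zero]
    intro l hl
    exfalso
    simp only [Finset.mem_filter, mem_parts] at hl
    obtain ⟨h1, h2⟩ := hl
    rw [mem_frobSet] at h2
    have h3 : (0, 0) ∈ l := by
      by_contra hne
      have : l.cells = ∅ := by
        rw [Finset.eq_empty_iff_forall_notMem]
        intro c hc
        exact hne (l.up_left_mem (Nat.zero_le _) (Nat.zero_le _) hc)
      rw [this] at h1
      exact hd (by simpa using h1.symm)
    have h4 := h2 0 h3
    have h5 := rowLen_zero_le_card l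
    have h6 : 0 < l.colLen 0 := YoungDiagram.mem_iff_lt_colLen.1 h3
    omega

lemma SP_zero {R : Type*} [CommRing R] (h : ℕ → R) :
    SP h (fun l => l ∈ frobSet 0) (sg 0) 0 = 1 := by
  classical
  have : (parts 0).filter (fun l => l ∈ frobSet 0) = {⊥} := by
    ext l
    simp only [Finset.mem_filter, mem_parts, Finset.mem_singleton, Finset.card_eq_zero]
    constructor
    · rintro ⟨h1, _⟩
      exact YoungDiagram.ext (by simpa using h1)
    · rintro rfl
      refine ⟨by simp, ?_⟩
      rw [mem_frobSet]
      intro k hk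
      exact absurd hk (by simp)
  rw [SP, this, Finset.sum_singleton]
  have e : sS h ⊥ = 1 := by
    rw [sS, show (⊥ : YoungDiagram).cells.card = 0 from rfl]
    exact Matrix.det_isEmpty
  simp [sg_eq (p := 0) (l := ⊥) (t := 0) (by simp [frobRank]), e]

lemma final_L {L : Type*} [Field L] [IsAlgClosed L] (h : ℕ → L) (h0 : h 0 = 1) (p : ℕ) :
    PowerSeries.mk (SP h (fun l => l.rowLen 0 ≤ p) (fun _ => 1)) =
    PowerSeries.mk (SP h (fun _ => True) (fun _ => 1)) *
      PowerSeries.mk (SP h (fun l => l ∈ frobSet p) (sg p)) := by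
  have inv : PowerSeries.mk (SP h (fun _ => True) (fun _ => 1)) *
      PowerSeries.mk (SP h (fun l => l ∈ frobSet 0) (sg 0)) = 1 := by
    ext d
    have := congrArg (PowerSeries.coeff d) (key_L h h0 d)
    rw [PowerSeries.coeff_mk, SP_frob_self, SP_zero] at this
    rw [PowerSeries.coeff_one, ← this, PowerSeries.coeff_mul, PowerSeries.coeff_mul]
    refine Finset.sum_congr rfl fun z hz => ?_
    have hz' := Finset.HasAntidiagonal.mem_antidiagonal.1 hz
    simp only [PowerSeries.coeff_mk]
    congr 1
    unfold SP
    refine Finset.sum_congr ?_ fun _ _ => rfl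
    ext l
    simp only [Finset.mem_filter, mem_parts]
    have := rowLen_zero_le_card l
    constructor
    · rintro ⟨h1, _⟩; exact ⟨h1, by omega⟩
    · rintro ⟨h1, _⟩; exact ⟨h1, trivial⟩
  rw [← key_L h h0 p]
  calc _ = PowerSeries.mk (SP h (fun l => l.rowLen 0 ≤ p) (fun _ => 1)) * 1 := (mul_one _).symm
    _ = _ := by rw [← inv]; ring

lemma final_R {R : Type*} [CommRing R] [IsDomain R] (h : ℕ → R) (h0 : h 0 = 1) (p d : ℕ) :
    SP h (fun l => l.rowLen 0 ≤ p) (fun _ => 1) d =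
    ∑ z ∈ antidiagonal d, SP h (fun _ => True) (fun _ => 1) z.1 *
      SP h (fun l => l ∈ frobSet p) (sg p) z.2 := by
  let f : R →+* AlgebraicClosure (FractionRing R) :=
    (algebraMap (FractionRing R) (AlgebraicClosure (FractionRing R))).comp
      (algebraMap R (FractionRing R))
  have hf : Function.Injective f :=
    (algebraMap (FractionRing R) (AlgebraicClosure (FractionRing R))).injective.comp
      (IsFractionRing.injective R (FractionRing R))
  apply hf
  have := congrArg (PowerSeries.coeff d) (final_L (fun k => f (h k)) (by rw [h0, map_one]) p)
  rw [PowerSeries.coeff_mul, PowerSeries.coeff_mk] at this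
  rw [SP_map, this, map_sum]
  refine Finset.sum_congr rfl fun z _ => ?_
  rw [map_mul, SP_map, SP_map, PowerSeries.coeff_mk, PowerSeries.coeff_mk]

end HWF

namespace HWF
open Finset

lemma coeff_sS (m n : ℕ) (l : YoungDiagram) (d : (Fin m ⊕ Fin n) →₀ ℕ) :
    MvPowerSeries.coeff d (sS (hXY (Xv m n) (Yv m n) n m) l) = (superSchurCoeff m n l d : ℚ) := by
  rw [coeff_super m n l.cells.card (rowLen_card l) d]; rfl

lemma coeff_SP (m n : ℕ) (P : YoungDiagram → Prop) (c : YoungDiagram → ℤ) (e : ℕ)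
    (d : (Fin m ⊕ Fin n) →₀ ℕ) [DecidablePred P] :
    MvPowerSeries.coeff d (SP (hXY (Xv m n) (Yv m n) n m) P c e) =
      ∑ l ∈ (parts e).filter P, (c l : ℚ) * (superSchurCoeff m n l d : ℚ) := by
  classical
  rw [SP, map_sum]
  refine Finset.sum_congr (by congr) fun l _ => ?_
  rw [← coeff_sS, ← map_intCast (MvPowerSeries.C (σ := Fin m ⊕ Fin n) (R := ℚ)) (c l),
    MvPowerSeries.coeff_C_mul]

lemma coeff_SP_zero (m n : ℕ) (P : YoungDiagram → Prop) (c : YoungDiagram → ℤ) (e : ℕ)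
    (d : (Fin m ⊕ Fin n) →₀ ℕ) (he : e ≠ ∑ k, d k) :
    MvPowerSeries.coeff d (SP (hXY (Xv m n) (Yv m n) n m) P c e) = 0 := by
  classical
  rw [coeff_SP]
  refine Finset.sum_eq_zero fun l hl => ?_
  rw [Finset.mem_filter, mem_parts] at hl
  by_cases h : superSchurCoeff m n l d = 0
  · simp [h]
  · exact absurd (hl.1.symm.trans (superSchurCoeff_degree m n h)) he

lemma coeff_superSum (m n : ℕ) (S : Set YoungDiagram) (P : YoungDiagram → Prop)
    (c : YoungDiagram → ℚ) (cz : YoungDiagram → ℤ)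
    (hS : ∀ l, l ∈ S ↔ l.rowLen m ≤ n ∧ P l) (hc : ∀ l, P l → c l = cz l)
    (d : (Fin m ⊕ Fin n) →₀ ℕ) :
    MvPowerSeries.coeff d (superSchurSum m n S c) =
      MvPowerSeries.coeff d (SP (hXY (Xv m n) (Yv m n) n m) P cz (∑ k, d k)) := by
  classical
  rw [coeff_SP]
  change ∑' lam : S, c lam * (superSchurCoeff m n (lam : YoungDiagram) d : ℚ) = _
  rw [tsum_subtype S (fun l => c l * (superSchurCoeff m n l d : ℚ)),
    tsum_eq_sum (s := (parts (∑ k, d k)).filter P)]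
  · refine Finset.sum_congr rfl fun l hl => ?_
    rw [Finset.mem_filter, mem_parts] at hl
    by_cases h : superSchurCoeff m n l d = 0
    · simp [Set.indicator_apply, h]
    · rw [Set.indicator_of_mem ((hS l).2 ⟨superSchurCoeff_hook m n h, hl.2⟩), hc l hl.2]
  · intro l hl
    rw [Set.indicator_apply]
    split_ifs with hm
    · by_cases h : superSchurCoeff m n l d = 0
      · simp [h]
      · exfalso; apply hl
        rw [Finset.mem_filter, mem_parts]
        exact ⟨superSchurCoeff_degree m n h, ((hS l).1 hm).2⟩
    · rfl

lemma sg_exp {p : ℕ} (hp : 0 < p) (l : YoungDiagram) (hl : l ∈ frobSet p) :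
    (-1 : ℚ) ^ ((l.cells.card - frobRank l * (p - 1)) / 2) = (sg p l : ℚ) := by
  obtain ⟨t, ht⟩ := frob_parity l.cells.card l (mem_PF.2 ⟨hl, rowLen_card l⟩)
  rw [sg_eq ht]
  have : (l.cells.card - frobRank l * (p - 1)) / 2 = t := by
    obtain ⟨q, rfl⟩ : ∃ q, p = q + 1 := ⟨p - 1, by omega⟩
    rw [Nat.add_sub_cancel]
    rw [Nat.mul_succ] at ht
    omega
  rw [this]; push_cast; rfl

theorem final (m n p : ℕ) (hp : 0 < p) :
    superSchurSum m n {lam : YoungDiagram | lam.rowLen m ≤ n ∧ lam.rowLen 0 ≤ p}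
        (fun _ => 1)
    = superSchurSum m n {lam : YoungDiagram | lam.rowLen m ≤ n} (fun _ => 1)
      * superSchurSum m n ({lam : YoungDiagram | lam.rowLen m ≤ n} ∩ frobSet p)
          (fun lam => (-1 : ℚ)^((lam.cells.card - frobRank lam * (p-1))/2)) := by
  classical
  haveI : IsDomain (MvPowerSeries (Fin m ⊕ Fin n) ℚ) := NoZeroDivisors.to_isDomain _
  ext d
  rw [MvPowerSeries.coeff_mul, coeff_superSum m n {lam : YoungDiagram | lam.rowLen m ≤ n ∧ lam.rowLen 0 ≤ p} (fun l => l.rowLen 0 ≤ p) _ (fun _ => 1)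
    (fun l => Iff.rfl) (fun _ _ => by simp),
    final_R _ (hXY_zero _ _ _ _), map_sum]
  simp only [MvPowerSeries.coeff_mul]
  rw [Finset.sum_comm]
  refine Finset.sum_congr rfl fun z hz => ?_
  have hz' := Finset.HasAntidiagonal.mem_antidiagonal.1 hz
  rw [coeff_superSum m n {lam : YoungDiagram | lam.rowLen m ≤ n} (fun _ => True) _ (fun _ => 1)
    (fun l => by simp) (fun _ _ => by simp),
    coeff_superSum m n ({lam : YoungDiagram | lam.rowLen m ≤ n} ∩ frobSet p) (fun l => l ∈ frobSet p) _ (sg p)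
    (fun l => Iff.rfl) (fun l hl => sg_exp hp l hl)]
  rw [Finset.sum_eq_single (∑ k, z.1 k, ∑ k, z.2 k)]
  · intro w hw hne
    by_cases h1 : w.1 = ∑ k, z.1 k
    · rw [coeff_SP_zero m n _ _ w.2 z.2, mul_zero]
      intro h2; exact hne (Prod.ext h1 h2)
    · rw [coeff_SP_zero m n _ _ w.1 z.1 h1, zero_mul]
  · intro hne
    exfalso; apply hne
    rw [Finset.HasAntidiagonal.mem_antidiagonal, ← hz', ← Finset.sum_add_distrib]
    rfl

end HWF

/-- for every positive integer `p`,
`Σ_{λ∈H, λ_1≤p} s_λ(x|y) = (Σ_{ν∈H} s_ν(x|y)) ·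
  (Σ_{σ∈H_p} (-1)^{(|σ|-r(σ)(p-1))/2} s_σ(x|y))`. -/
theorem hook_width_factorization (m n p : ℕ) (hm : 0 < m) (hn : 0 < n) (hp : 0 < p) :
    superSchurSum m n {lam : YoungDiagram | lam.rowLen m ≤ n ∧ lam.rowLen 0 ≤ p}
        (fun _ => 1)
    = superSchurSum m n {lam : YoungDiagram | lam.rowLen m ≤ n} (fun _ => 1)
      * superSchurSum m n ({lam : YoungDiagram | lam.rowLen m ≤ n} ∩ frobSet p)
          (fun lam => (-1 : ℚ)^((lam.cells.card - frobRank lam * (p-1))/2)) := by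
  exact HWF.final m n p hp

end
end
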